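/- arXiv:0911.3919 — 3 statements merged into one kernel-verified Lean document; each statement's English description precedes it below -/
import Mathlib

section
/- For every isometry g of V there exists a unique w ∈ W such that w⁻¹ ∘ g has a fixed point in D°; that is, there exist w ∈ W and x ∈ D° with g x = w x, and whenever g x₁ = w₁ x₁ and g x₂ = w₂ x₂ with x₁, x₂ ∈ D° and w₁, w₂ ∈ W, one has w₁ = w₂. -/
open scoped RealInnerProductSpace

noncomputable section

/-- `g` is the orthogonal reflection in the affine hyperplane `{x | ⟪x, u⟫ = c}`. -/
def IsAffRefl {V : Type*} [NormedAddCommGroup V] [InnerProductSpace ℝ V]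
    (g : V ≃ᵢ V) : Prop :=
  ∃ (u : V) (c : ℝ), u ≠ 0 ∧ ∀ x : V, g x = x - ((2 * (⟪x, u⟫ - c)) / ⟪u, u⟫) • u

/-- The union of the reflection hyperplanes (mirrors) of the reflections belonging to `W`;
the mirror of a reflection is exactly its set of fixed points. -/
def affMirrors {V : Type*} [NormedAddCommGroup V] [InnerProductSpace ℝ V]
    (W : Subgroup (V ≃ᵢ V)) : Set V :=
  ⋃ g ∈ {g : V ≃ᵢ V | g ∈ W ∧ IsAffRefl g}, {x : V | g x = x}


namespace FixPt

variable {V : Type*} [NormedAddCommGroup V] [InnerProductSpace ℝ V]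

/-- `r ∈ W` is the reflection in the hyperplane `⟪x, u⟫ = c`. -/
def Dat (W : Subgroup (V ≃ᵢ V)) (r : V ≃ᵢ V) (u : V) (c : ℝ) : Prop :=
  r ∈ W ∧ u ≠ 0 ∧ ∀ x : V, r x = x - ((2 * (⟪x, u⟫ - c)) / ⟪u, u⟫) • u

structure Ax (W : Subgroup (V ≃ᵢ V)) (D : Set V) (x₀ : V) : Prop where
  ne : ∀ r u c, Dat W r u c → ⟪x₀, u⟫ - c ≠ 0
  memD : ∀ v, v ∈ D ↔ ∀ r u c, Dat W r u c → 0 ≤ (⟪v, u⟫ - c) * (⟪x₀, u⟫ - c)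
  int : ∀ v, v ∈ interior D ↔ v ∈ D ∧ ∀ r u c, Dat W r u c → ⟪v, u⟫ - c ≠ 0
  x0int : x₀ ∈ interior D
  dense : D = closure (interior D)
  cpt : IsCompact D
  hpd : ∀ K : Set V, IsCompact K → {g : V ≃ᵢ V | g ∈ W ∧ ∃ x ∈ K, g x ∈ K}.Finite
  cover : ∀ v : V, ∃ w ∈ W, ∃ x ∈ D, w x = v
  disj : ∀ w ∈ W, ∀ w' ∈ W, w ≠ w' →
      ∀ x ∈ interior D, ∀ x' ∈ interior D, w x ≠ w' x'

theorem Dat.fix_iff {W : Subgroup (V ≃ᵢ V)} {r : V ≃ᵢ V} {u : V} {c : ℝ} (h : Dat W r u c)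
    (x : V) : r x = x ↔ ⟪x, u⟫ - c = 0 := by
  obtain ⟨-, hu, h⟩ := h
  have : (⟪u, u⟫ : ℝ) ≠ 0 := by simpa using hu
  rw [h x, sub_eq_self, smul_eq_zero]
  simp [hu]

theorem Dat.sq {W : Subgroup (V ≃ᵢ V)} {r : V ≃ᵢ V} {u : V} {c : ℝ} (h : Dat W r u c)
    (a v : V) : ‖a - r v‖ ^ 2 = ‖a - v‖ ^ 2 + 4 * ((⟪v, u⟫ - c) * (⟪a, u⟫ - c)) / ⟪u, u⟫ := by
  obtain ⟨-, hu, h⟩ := h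
  have h0 : (⟪u, u⟫ : ℝ) ≠ 0 := by simpa using hu
  rw [h v, sub_sub_eq_add_sub, add_sub_right_comm, norm_add_sq_real, norm_smul, mul_pow,
    inner_smul_right, inner_sub_left, ← real_inner_self_eq_norm_sq u, Real.norm_eq_abs, sq_abs]
  field_simp
  ring

theorem mk_ax [FiniteDimensional ℝ V]
    (W : Subgroup (V ≃ᵢ V)) (D : Set V)
    (hlf : LocallyFinite fun g : {g : V ≃ᵢ V // g ∈ W ∧ IsAffRefl g} => {x : V | g.1 x = x})
    (hpd : ∀ K : Set V, IsCompact K → {g : V ≃ᵢ V | g ∈ W ∧ ∃ x ∈ K, g x ∈ K}.Finite)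
    (hD : ∃ x₀ ∈ (affMirrors W)ᶜ, D = closure (connectedComponentIn (affMirrors W)ᶜ x₀))
    (hDcpt : IsCompact D)
    (hcover : ∀ v : V, ∃ w ∈ W, ∃ x ∈ D, w x = v)
    (hdisj : ∀ w ∈ W, ∀ w' ∈ W, w ≠ w' →
      ∀ x ∈ interior D, ∀ x' ∈ interior D, w x ≠ w' x') : ∃ x₀, Ax W D x₀ := by
  obtain ⟨x₀, hx₀, hDe⟩ := hD
  have hmir : ∀ v, v ∈ (affMirrors W)ᶜ ↔ ∀ r u c, Dat W r u c → ⟪v, u⟫ - c ≠ 0 := by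
    intro v
    simp only [affMirrors, Set.mem_compl_iff, Set.mem_iUnion, Set.mem_setOf_eq, not_exists]
    constructor
    · intro H r u c hd h0
      exact H r ⟨hd.1, u, c, hd.2⟩ ((hd.fix_iff v).2 h0)
    · rintro H r ⟨hr, u, c, hd⟩ h0
      exact H r u c ⟨hr, hd⟩ ((Dat.fix_iff ⟨hr, hd⟩ v).1 h0)
  have hop : IsOpen (affMirrors W)ᶜ := by
    rw [isOpen_compl_iff]
    have : affMirrors W = ⋃ g : {g : V ≃ᵢ V // g ∈ W ∧ IsAffRefl g}, {x : V | g.1 x = x} := by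
      ext x
      simp [affMirrors]
    rw [this]
    exact hlf.isClosed_iUnion fun g => isClosed_eq g.1.continuous continuous_id
  set C := connectedComponentIn (affMirrors W)ᶜ x₀ with hC
  have hCo : IsOpen C := hop.connectedComponentIn
  have hx₀C : x₀ ∈ C := mem_connectedComponentIn hx₀
  have hne := (hmir x₀).1 hx₀
  have hCle : ∀ v ∈ C, ∀ r u c, Dat W r u c → 0 < (⟪v, u⟫ - c) * (⟪x₀, u⟫ - c) := by
    intro v hv r u c hd
    by_contra hcon
    push Not at hcon
    have hpre : IsPreconnected C := isPreconnected_connectedComponentIn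
    have h1 := hpre.intermediate_value hv hx₀C
      (f := fun v => (⟪v, u⟫ - c) * (⟪x₀, u⟫ - c)) (by fun_prop)
    obtain ⟨y, hy, hy0⟩ := h1 ⟨hcon, mul_self_nonneg _⟩
    have := (hmir y).1 (connectedComponentIn_subset _ _ hy) r u c hd
    exact (mul_ne_zero this (hne r u c hd)) hy0
  have hCge : ∀ v, (∀ r u c, Dat W r u c → 0 < (⟪v, u⟫ - c) * (⟪x₀, u⟫ - c)) → v ∈ C := by
    intro v hv
    have hconv : Convex ℝ {v : V | ∀ r u c, Dat W r u c →
        0 < (⟪v, u⟫ - c) * (⟪x₀, u⟫ - c)} := by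
      intro a ha b hb s t hs ht hst r u c hd
      have h1 := ha r u c hd
      have h2 := hb r u c hd
      rw [inner_add_left, real_inner_smul_left, real_inner_smul_left]
      have : (s * ⟪a, u⟫ + t * ⟪b, u⟫ - c) * (⟪x₀, u⟫ - c) =
        s * ((⟪a, u⟫ - c) * (⟪x₀, u⟫ - c)) + t * ((⟪b, u⟫ - c) * (⟪x₀, u⟫ - c)) := by
        obtain rfl : s = 1 - t := by linarith
        ring
      rw [this]
      rcases hs.lt_or_eq with h | h
      · have := mul_pos h h1
        have := mul_nonneg ht h2.le
        linarith
      · subst h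
        obtain rfl : t = 1 := by linarith
        linarith
    refine hconv.isPreconnected.subset_connectedComponentIn
      (fun r u c hd => mul_self_pos.2 (hne r u c hd)) ?_ hv
    intro y hy
    exact (hmir y).2 fun r u c hd h0 => by
      have := hy r u c hd
      rw [h0] at this
      simp at this
  have hCint : C ⊆ interior D := by
    rw [hDe]
    exact interior_maximal subset_closure hCo
  have hmemD : ∀ v, v ∈ D ↔ ∀ r u c, Dat W r u c → 0 ≤ (⟪v, u⟫ - c) * (⟪x₀, u⟫ - c) := by
    intro v
    constructor
    · intro hv r u c hd
      have hcl : IsClosed {v : V | 0 ≤ (⟪v, u⟫ - c) * (⟪x₀, u⟫ - c)} :=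
        isClosed_le continuous_const (by fun_prop)
      rw [hDe] at hv
      exact closure_minimal (fun y hy => (hCle y hy r u c hd).le) hcl hv
    · intro hv
      rw [hDe]
      have hlim : Filter.Tendsto (fun n : ℕ => v + (1 / ((n : ℝ) + 1)) • (x₀ - v))
          Filter.atTop (nhds (v + (0 : ℝ) • (x₀ - v))) :=
        tendsto_const_nhds.add (tendsto_one_div_add_atTop_nhds_zero_nat.smul_const _)
      rw [zero_smul, add_zero] at hlim
      refine mem_closure_of_tendsto hlim (Filter.Eventually.of_forall fun n => ?_)
      apply hCge
      intro r u c hd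
      have h1 := hv r u c hd
      have h2 := mul_self_pos.2 (hne r u c hd)
      have h3 : 0 < 1 / ((n : ℝ) + 1) := by positivity
      have h4 : 1 / ((n : ℝ) + 1) ≤ 1 := by
        rw [div_le_one (by positivity)]
        linarith [Nat.cast_nonneg (α := ℝ) n]
      set s := 1 / ((n : ℝ) + 1)
      rw [inner_add_left, real_inner_smul_left, inner_sub_left]
      have h5 := mul_pos h3 h2
      have h6 := mul_nonneg (sub_nonneg.2 h4) h1
      nlinarith
  have hintD : ∀ v ∈ interior D, ∀ r u c, Dat W r u c → ⟪v, u⟫ - c ≠ 0 := by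
    intro v hv r u c hd h0
    refine hdisj r hd.1 1 W.one_mem ?_ v hv v hv ((hd.fix_iff v).2 h0)
    rintro rfl
    exact hne _ u c hd ((hd.fix_iff x₀).1 rfl)
  refine ⟨x₀, hne, hmemD, ?_, hCint hx₀C, ?_, hDcpt, hpd, hcover, hdisj⟩
  · intro v
    refine ⟨fun h => ⟨interior_subset h, hintD v h⟩, fun ⟨h1, h2⟩ => hCint (hCge v ?_)⟩
    intro r u c hd
    exact lt_of_le_of_ne ((hmemD v).1 h1 r u c hd)
      (mul_ne_zero (h2 r u c hd) (hne r u c hd)).symm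
  · apply subset_antisymm
    · conv_lhs => rw [hDe]
      exact closure_mono hCint
    · exact closure_minimal interior_subset hDcpt.isClosed

variable {W : Subgroup (V ≃ᵢ V)} {D : Set V} {x₀ : V}

theorem Ax.convex (A : Ax W D x₀) : Convex ℝ D := by
  intro a ha b hb s t hs ht hst
  rw [A.memD] at *
  intro r u c hd
  have h1 := mul_nonneg hs (ha r u c hd)
  have h2 := mul_nonneg ht (hb r u c hd)
  rw [inner_add_left, real_inner_smul_left, real_inner_smul_left]
  obtain rfl : s = 1 - t := by linarith
  nlinarith

/-- A point outside `D` can be moved closer to an interior point by a reflection. -/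
theorem Ax.closer (A : Ax W D x₀) {a v : V} (ha : a ∈ interior D) (hv : v ∉ D) :
    ∃ r ∈ W, dist a (r v) < dist a v := by
  rw [A.memD] at hv
  push Not at hv
  obtain ⟨r, u, c, hd, h⟩ := hv
  refine ⟨r, hd.1, ?_⟩
  obtain ⟨h1, h2⟩ := (A.int a).1 ha
  have h3 := (A.memD a).1 h1 r u c hd
  have h4 := lt_of_le_of_ne h3 (mul_ne_zero (h2 r u c hd) (A.ne r u c hd)).symm
  have h5 := A.ne r u c hd
  have h6 : (⟪v, u⟫ - c) * (⟪a, u⟫ - c) < 0 := by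
    rcases h5.lt_or_gt with h5 | h5
    · have := neg_of_mul_pos_left h4 h5.le
      have := pos_of_mul_neg_left h h5.le
      exact mul_neg_of_pos_of_neg ‹_› ‹_›
    · have := pos_of_mul_pos_left h4 h5.le
      have := neg_of_mul_neg_left h h5.le
      exact mul_neg_of_neg_of_pos ‹_› ‹_›
  have h7 := hd.sq a v
  have h8 : 0 < ⟪u, u⟫ := real_inner_self_pos.2 hd.2.1
  have h9 : 4 * ((⟪v, u⟫ - c) * (⟪a, u⟫ - c)) / ⟪u, u⟫ < 0 :=
    div_neg_of_neg_of_pos (by linarith) h8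
  rw [dist_eq_norm, dist_eq_norm]
  exact lt_of_pow_lt_pow_left₀ 2 (norm_nonneg _) (by linarith)

theorem Ax.eq_one (A : Ax W D x₀) {w : V ≃ᵢ V} (hw : w ∈ W) {b : V} (hb : b ∈ interior D)
    (h : w b ∈ D) : w = 1 := by
  by_contra hne
  rw [A.dense] at h
  have ho : IsOpen (w '' interior D) := w.toHomeomorph.isOpenMap _ isOpen_interior
  obtain ⟨y, ⟨z, hz, hzy⟩, hy⟩ := mem_closure_iff.1 h _ ho ⟨b, hb, rfl⟩
  exact A.disj w hw 1 W.one_mem hne z hz y hy hzy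

theorem Ax.dist_le [FiniteDimensional ℝ V] (A : Ax W D x₀) {a b : V} (ha : a ∈ D) (hb : b ∈ D)
    {w : V ≃ᵢ V} (hw : w ∈ W) : dist a b ≤ dist a (w b) := by
  have key : ∀ a ∈ interior D, ∀ b ∈ interior D, dist a b ≤ dist a (w b) := by
    intro a ha b hb
    by_contra hlt
    push Not at hlt
    have hfin : {k : V ≃ᵢ V | k ∈ W ∧ dist a (k b) ≤ dist a b}.Finite := by
      refine (A.hpd (Metric.closedBall a (dist a b)) (isCompact_closedBall _ _)).subset ?_
      rintro k ⟨hk, h⟩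
      refine ⟨hk, b, ?_, ?_⟩
      · simp [dist_comm]
      · simpa [dist_comm] using h
    obtain ⟨k, ⟨hk, hk1⟩, hk2⟩ := hfin.exists_minimalFor (fun k => dist a (k b)) _ ⟨w, hw, hlt.le⟩
    have hkD : k b ∈ D := by
      by_contra hn
      obtain ⟨r, hr, hrl⟩ := A.closer ha hn
      have := hk2 (j := r * k) ⟨W.mul_mem hr hk, hrl.le.trans hk1⟩ hrl.le
      exact absurd hrl (not_lt.2 this)
    obtain rfl := A.eq_one hk hb hkD
    have := hk2 (j := w) ⟨hw, hlt.le⟩ hlt.le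
    exact absurd hlt (not_lt.2 this)
  rw [A.dense] at ha hb
  have hcl : IsClosed {p : V × V | dist p.1 p.2 ≤ dist p.1 (w p.2)} :=
    isClosed_le (by fun_prop) (continuous_fst.dist (w.continuous.comp continuous_snd))
  have : (a, b) ∈ closure (interior D ×ˢ interior D) := by
    rw [closure_prod_eq]; exact ⟨ha, hb⟩
  exact closure_minimal (fun p hp => key _ hp.1 _ hp.2) hcl this

theorem Ax.unique [FiniteDimensional ℝ V] (A : Ax W D x₀) {a b : V} (ha : a ∈ interior D)
    (hb : b ∈ interior D) {w : V ≃ᵢ V} (hw : w ∈ W) (h : dist a b = dist a (w b)) : w = 1 := by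
  by_cases hD : w b ∈ D
  · exact A.eq_one hw hb hD
  · obtain ⟨r, hr, hrl⟩ := A.closer ha hD
    have := A.dist_le (interior_subset ha) (interior_subset hb) (W.mul_mem hr hw)
    rw [IsometryEquiv.mul_apply] at this
    linarith

theorem Ax.orbit_eq [FiniteDimensional ℝ V] (A : Ax W D x₀) {a : V} (ha : a ∈ D)
    {w : V ≃ᵢ V} (hw : w ∈ W) (h : w a ∈ D) : w a = a := by
  have := A.dist_le h ha hw
  rw [dist_self] at this
  exact dist_le_zero.1 this

theorem inner_iso (k : V ≃ᵢ V) (x a b : V) :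
    (⟪k a - k x, k b - k x⟫ : ℝ) = ⟪a - x, b - x⟫ := by
  have h : ∀ a b : V, ‖k a - k b‖ = ‖a - b‖ := fun a b => by
    rw [← dist_eq_norm, ← dist_eq_norm, k.dist_eq]
  rw [real_inner_eq_norm_mul_self_add_norm_mul_self_sub_norm_sub_mul_self_div_two,
    real_inner_eq_norm_mul_self_add_norm_mul_self_sub_norm_sub_mul_self_div_two,
    sub_sub_sub_cancel_right, sub_sub_sub_cancel_right, h, h, h]

theorem iso_affine (k : V ≃ᵢ V) {x : V} (hx : k x = x) (y : V) (s : ℝ) :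
    k (x + s • (y - x)) = x + s • (k y - x) := by
  have h : ∀ v, k v = k.toRealLinearIsometryEquiv v + k 0 := fun v => by simp
  have hx' := hx
  rw [h] at hx'
  rw [h (x + s • (y - x)), h y, map_add, map_smul, map_sub]
  have h2 : k.toRealLinearIsometryEquiv x = x - k 0 := eq_sub_of_add_eq hx'
  rw [h2]
  module

theorem Ax.delta [FiniteDimensional ℝ V] (A : Ax W D x₀) (x : V) :
    ∃ δ > 0, ∀ w ∈ W, dist (w x) x < δ → w x = x := by
  have hfin := ((A.hpd (Metric.closedBall x 1) (isCompact_closedBall _ _)).image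
    (fun w : V ≃ᵢ V => w x)).subset (Set.sdiff_subset (t := {x}))
  have hop := hfin.isClosed.isOpen_compl
  obtain ⟨ε, hε, hb⟩ := Metric.isOpen_iff.1 hop x (by simp)
  refine ⟨min ε 1, lt_min hε one_pos, fun w hw h => ?_⟩
  by_contra hne
  refine hb (Metric.mem_ball.2 (h.trans_le (min_le_left _ _))) ⟨⟨w, ⟨hw, x, ?_, ?_⟩, rfl⟩, hne⟩
  · simp
  · exact Metric.mem_closedBall.2 (h.le.trans (min_le_right _ _))

theorem Ax.cone (A : Ax W D x₀) {x : V} (hx : x ∈ D) {δ : ℝ}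
    (hδ : ∀ w ∈ W, dist (w x) x < δ → w x = x) {v : V} (hv : 2 * dist v x < δ)
    (h : ∀ r u c, Dat W r u c → r x = x → 0 ≤ (⟪v, u⟫ - c) * (⟪x₀, u⟫ - c)) : v ∈ D := by
  rw [A.memD]
  intro r u c hd
  by_contra hcon
  push Not at hcon
  refine absurd (h r u c hd ?_) (not_le.2 hcon)
  apply hδ r hd.1
  refine lt_of_le_of_lt ?_ hv
  have h1 := (A.memD x).1 hx r u c hd
  have h5 := A.ne r u c hd
  have hu : 0 < ‖u‖ := norm_pos_iff.2 hd.2.1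
  have h6 : |⟪x, u⟫ - c| ≤ |⟪v - x, u⟫| := by
    rw [inner_sub_left]
    rcases h5.lt_or_gt with h5 | h5
    · have h2 := nonpos_of_mul_nonneg_left h1 h5
      have h3 := pos_of_mul_neg_left hcon h5.le
      rw [abs_of_nonpos h2, abs_of_nonneg (by linarith)]
      linarith
    · have h2 := nonneg_of_mul_nonneg_left h1 h5
      have h3 := neg_of_mul_neg_left hcon h5.le
      rw [abs_of_nonneg h2, abs_of_nonpos (by linarith)]
      linarith
  have h7 := abs_real_inner_le_norm (v - x) u
  have h8 : r x - x = -(((2 * (⟪x, u⟫ - c)) / ⟪u, u⟫) • u) := by rw [hd.2.2 x]; abel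
  rw [dist_eq_norm, dist_eq_norm, h8, norm_neg, norm_smul, Real.norm_eq_abs, abs_div, abs_mul,
    real_inner_self_eq_norm_sq, abs_of_pos (by positivity : (0 : ℝ) < ‖u‖ ^ 2), abs_two]
  have h9 : 2 * |⟪x, u⟫ - c| / ‖u‖ ^ 2 * ‖u‖ = 2 * (|⟪x, u⟫ - c| / ‖u‖) := by
    field_simp
  rw [h9]
  have : |⟪x, u⟫ - c| / ‖u‖ ≤ ‖v - x‖ := by
    rw [div_le_iff₀ hu]; linarith
  linarith

/-- `f` is the composition of `g` with the folding map onto `D`. -/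
structure Fold (W : Subgroup (V ≃ᵢ V)) (D : Set V) (g : V ≃ᵢ V) (f : V → V) : Prop where
  mem : ∀ v, f v ∈ D
  orb : ∀ v, ∃ u ∈ W, f v = u (g v)

variable {g : V ≃ᵢ V} {f : V → V}

theorem Ax.exists_fold (A : Ax W D x₀) (g : V ≃ᵢ V) : ∃ f, Fold W D g f := by
  choose w hw p hp h using A.cover
  refine ⟨fun v => p (g v), fun v => hp _, fun v => ⟨(w (g v))⁻¹, W.inv_mem (hw _), ?_⟩⟩
  have := congrArg (fun z => (w (g v))⁻¹ z) (h (g v))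
  simpa using this

section
variable [FiniteDimensional ℝ V]

theorem Fold.eq_of (A : Ax W D x₀) (F : Fold W D g f) {v : V} {u : V ≃ᵢ V} (hu : u ∈ W)
    (h : u (g v) ∈ D) : f v = u (g v) := by
  obtain ⟨k, hk, hkv⟩ := F.orb v
  have h1 : (k * u⁻¹) (u (g v)) = f v := by simp [IsometryEquiv.mul_apply, hkv]
  have := A.orbit_eq h (W.mul_mem hk (W.inv_mem hu)) (by rw [h1]; exact F.mem v)
  rw [← h1, this]

theorem Fold.lip (A : Ax W D x₀) (F : Fold W D g f) (a b : V) :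
    dist (f a) (f b) ≤ dist a b := by
  obtain ⟨k, hk, hka⟩ := F.orb a
  obtain ⟨l, hl, hlb⟩ := F.orb b
  have := A.dist_le (F.mem a) (F.mem b) (W.mul_mem hk (W.inv_mem hl))
  have h1 : (k * l⁻¹) (f b) = k (g b) := by simp [IsometryEquiv.mul_apply, hlb]
  rw [h1] at this
  refine this.trans_eq ?_
  rw [hka, k.dist_eq, g.dist_eq]

theorem Fold.cont (A : Ax W D x₀) (F : Fold W D g f) : Continuous f :=
  (LipschitzWith.of_dist_le_mul (K := 1) (by simpa using F.lip A)).continuous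

theorem Fold.anchor (A : Ax W D x₀) (F : Fold W D g f) {q : V} (hq : q ∈ D) {t : ℝ}
    (ht : 0 < t) (ht1 : t ≤ 1) : ∃ y ∈ D, y = (1 - t) • f y + t • q := by
  have hc : ContractingWith (Real.toNNReal (1 - t)) (fun y => (1 - t) • f y + t • q) := by
    refine ⟨?_, LipschitzWith.of_dist_le_mul fun a b => ?_⟩
    · rw [Real.toNNReal_lt_one]
      linarith
    · rw [Real.coe_toNNReal _ (by linarith), dist_add_right, dist_smul₀, Real.norm_of_nonneg (by linarith)]
      exact mul_le_mul_of_nonneg_left (F.lip A a b) (by linarith)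
  have h := hc.fixedPoint_isFixedPt
  refine ⟨ContractingWith.fixedPoint _ hc, ?_, h.symm⟩
  rw [← h]
  exact A.convex (F.mem _) hq (by linarith) ht.le (by ring)

theorem Fold.approx (A : Ax W D x₀) (F : Fold W D g f) {K : Set V} (hK : IsCompact K)
    (h : ∀ ε > 0, ∃ y ∈ K, dist y (f y) ≤ ε) : ∃ y ∈ K, f y = y := by
  obtain ⟨y₁, hy₁, -⟩ := h 1 one_pos
  obtain ⟨y, hy, hmin⟩ := hK.exists_isMinOn ⟨y₁, hy₁⟩
    (f := fun y => dist y (f y)) (continuous_id.dist (F.cont A)).continuousOn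
  refine ⟨y, hy, ?_⟩
  by_contra hne
  have hpos : 0 < dist y (f y) := dist_pos.2 (Ne.symm hne)
  obtain ⟨z, hz, hz1⟩ := h (dist y (f y) / 2) (by linarith)
  have : dist y (f y) ≤ dist z (f z) := hmin hz
  linarith

theorem Fold.exists_fixed (A : Ax W D x₀) (F : Fold W D g f) : ∃ y ∈ D, f y = y := by
  refine F.approx A A.cpt fun ε hε => ?_
  have hq := interior_subset A.x0int
  obtain ⟨R, hR⟩ := A.cpt.isBounded.subset_closedBall x₀
  have hR0 : 0 ≤ R := by simpa using hR hq
  obtain ⟨y, hy, h⟩ := F.anchor A hq (t := min 1 (ε / (R + 1))) (by positivity) (min_le_left _ _)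
  set t := min 1 (ε / (R + 1)) with ht
  have ht0 : 0 < t := by positivity
  refine ⟨y, hy, ?_⟩
  have h1 : y - f y = t • (x₀ - f y) := by
    nth_rewrite 1 [h]
    module
  have h2 : ‖f y - x₀‖ ≤ R := by
    rw [← dist_eq_norm]; exact hR (F.mem y)
  rw [dist_eq_norm, h1, norm_smul, Real.norm_of_nonneg ht0.le, norm_sub_rev]
  have h3 : t * (R + 1) ≤ ε := by
    rw [← le_div_iff₀ (by linarith)]; exact min_le_right _ _
  nlinarith

end

/-- the direction `b` used to perturb a fixed point `x` lying on a mirror -/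
theorem Ax.exists_dir [FiniteDimensional ℝ V] (A : Ax W D x₀) (x : V) :
    ∃ b : V, (∀ e, (∀ w ∈ W, w x = x → w e = e) → (⟪b, e - x⟫ : ℝ) = 0) ∧
      (∀ v ∈ D, (0 : ℝ) ≤ ⟪b, v - x⟫) ∧
      (∀ r u c, Dat W r u c → r x = x → (⟪b, u⟫ : ℝ) = ⟪x₀, u⟫ - c) := by
  have hfin : {w : V ≃ᵢ V | w ∈ W ∧ w x = x}.Finite := by
    refine (A.hpd {x} isCompact_singleton).subset ?_
    rintro w ⟨hw, h⟩
    exact ⟨hw, x, rfl, h⟩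
  set S := hfin.toFinset with hS
  have hmem : ∀ w, w ∈ S ↔ w ∈ W ∧ w x = x := fun w => by simp [hS]
  have h1S : (1 : V ≃ᵢ V) ∈ S := (hmem 1).2 ⟨W.one_mem, rfl⟩
  have hn : (0 : ℝ) < S.card := by exact_mod_cast Finset.card_pos.2 ⟨1, h1S⟩
  set n : ℝ := (S.card : ℝ) with hnd
  have hD := interior_subset A.x0int
  refine ⟨(x₀ - x) - n⁻¹ • ∑ w ∈ S, (w x₀ - x), ?_, ?_, ?_⟩
  · intro e he
    have : ∀ w ∈ S, (⟪w x₀ - x, e - x⟫ : ℝ) = ⟪x₀ - x, e - x⟫ := by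
      intro w hw
      obtain ⟨hw, hx⟩ := (hmem w).1 hw
      have := inner_iso w x x₀ e
      rwa [hx, he w hw hx] at this
    rw [inner_sub_left, real_inner_smul_left, sum_inner, Finset.sum_congr rfl this,
      Finset.sum_const, nsmul_eq_mul, ← hnd, inv_mul_cancel_left₀ hn.ne', sub_self]
  · intro v hv
    have : ∀ w ∈ S, (⟪w x₀ - x, v - x⟫ : ℝ) ≤ ⟪x₀ - x, v - x⟫ := by
      intro w hw
      obtain ⟨hw, hx⟩ := (hmem w).1 hw
      have h1 := A.dist_le hv hD hw
      have h2 : ‖w x₀ - x‖ = ‖x₀ - x‖ := by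
        rw [← dist_eq_norm, ← dist_eq_norm]
        conv_lhs => rw [← hx]
        exact w.dist_eq _ _
      rw [dist_comm v, dist_comm v, dist_eq_norm, dist_eq_norm,
        ← sub_sub_sub_cancel_right x₀ v x, ← sub_sub_sub_cancel_right (w x₀) v x] at h1
      have h3 := pow_le_pow_left₀ (norm_nonneg _) h1 2
      rw [norm_sub_sq_real (x₀ - x), norm_sub_sq_real (w x₀ - x), h2] at h3
      linarith
    have h4 := Finset.sum_le_sum this
    rw [Finset.sum_const, nsmul_eq_mul, ← hnd] at h4
    rw [inner_sub_left, real_inner_smul_left, sum_inner, sub_nonneg, inv_mul_le_iff₀ hn]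
    exact h4
  · intro r u c hd hr
    have hx0 := (hd.fix_iff x).1 hr
    have hrS : r ∈ S := (hmem r).2 ⟨hd.1, hr⟩
    have huu : (⟪u, u⟫ : ℝ) ≠ 0 := by simpa using hd.2.1
    have hre : ∑ w ∈ S, (⟪w x₀ - x, u⟫ : ℝ) = ∑ w ∈ S, (⟪(r * w) x₀ - x, u⟫ : ℝ) := by
      symm
      refine Finset.sum_nbij' (fun w => r * w) (fun w => r⁻¹ * w) ?_ ?_ ?_ ?_ ?_
      · intro w hw
        obtain ⟨hw, hx⟩ := (hmem w).1 hw
        exact (hmem _).2 ⟨W.mul_mem hd.1 hw, by rw [IsometryEquiv.mul_apply, hx, hr]⟩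
      · intro w hw
        obtain ⟨hw, hx⟩ := (hmem w).1 hw
        refine (hmem _).2 ⟨W.mul_mem (W.inv_mem hd.1) hw, ?_⟩
        rw [IsometryEquiv.mul_apply, hx]
        nth_rewrite 1 [← hr]
        simp
      · intro w _; simp
      · intro w _; simp
      · intro w _; rfl
    have hneg : ∀ w : V ≃ᵢ V, (⟪(r * w) x₀ - x, u⟫ : ℝ) = -⟪w x₀ - x, u⟫ := by
      intro w
      rw [IsometryEquiv.mul_apply, hd.2.2 (w x₀), inner_sub_left, inner_sub_left, inner_sub_left,
        real_inner_smul_left, div_mul_cancel₀ _ huu]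
      linarith
    simp only [hneg, Finset.sum_neg_distrib] at hre
    have h0 : ∑ w ∈ S, (⟪w x₀ - x, u⟫ : ℝ) = 0 := by linarith
    rw [inner_sub_left, real_inner_smul_left, sum_inner, h0, inner_sub_left]
    linarith

theorem Fold.step [FiniteDimensional ℝ V] (A : Ax W D x₀) (F : Fold W D g f) {x : V}
    (hx : x ∈ D) (hfx : f x = x) (hni : x ∉ interior D) :
    ∃ v ∈ D, f v = v ∧ {w : V ≃ᵢ V | w ∈ W ∧ w v = v} ⊂ {w : V ≃ᵢ V | w ∈ W ∧ w x = x} := by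
  obtain ⟨δ, hδ0, hδ⟩ := A.delta x
  obtain ⟨b, hb1, hb2, hb3⟩ := A.exists_dir x
  have hb0 : b ≠ 0 := by
    rintro rfl
    rw [A.int] at hni
    push Not at hni
    obtain ⟨r, u, c, hd, h0⟩ := hni hx
    have := hb3 r u c hd ((hd.fix_iff x).2 h0)
    rw [inner_zero_left] at this
    exact A.ne r u c hd this.symm
  have hbn : 0 < ‖b‖ := norm_pos_iff.2 hb0
  -- a small multiple of `b`
  obtain ⟨s, hs, hsb⟩ : ∃ s > 0, s * ‖b‖ = δ / 8 :=
    ⟨δ / 8 / ‖b‖, by positivity, by field_simp⟩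
  have hB : ‖s • b‖ = δ / 8 := by rw [norm_smul, Real.norm_of_nonneg hs.le, hsb]
  have hq : x + s • b ∈ D := by
    refine A.cone hx hδ ?_ ?_
    · rw [dist_eq_norm, add_sub_cancel_left, hB]; linarith
    · intro r u c hd hr
      have h0 := (hd.fix_iff x).1 hr
      rw [inner_add_left, real_inner_smul_left, hb3 r u c hd hr]
      have : 0 ≤ s * ((⟪x₀, u⟫ - c) * (⟪x₀, u⟫ - c)) := mul_nonneg hs.le (mul_self_nonneg _)
      have h1 : (⟪x, u⟫ + s * (⟪x₀, u⟫ - c) - c) * (⟪x₀, u⟫ - c) =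
        s * ((⟪x₀, u⟫ - c) * (⟪x₀, u⟫ - c)) := by
        have : (⟪x, u⟫ : ℝ) = c := by linarith
        rw [this]; ring
      rw [h1]; exact this
  -- scaling
  have hscale : ∀ y ∈ D, ∀ ρ : ℝ, 0 ≤ ρ → 2 * (ρ * ‖y - x‖) < δ → x + ρ • (y - x) ∈ D := by
    intro y hy ρ hρ hlt
    refine A.cone hx hδ ?_ ?_
    · rwa [dist_eq_norm, add_sub_cancel_left, norm_smul, Real.norm_of_nonneg hρ]
    · intro r u c hd hr
      have h0 := (hd.fix_iff x).1 hr
      have h1 := mul_nonneg hρ ((A.memD y).1 hy r u c hd)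
      rw [inner_add_left, real_inner_smul_left, inner_sub_left]
      have : (⟪x, u⟫ + ρ * (⟪y, u⟫ - ⟪x, u⟫) - c) * (⟪x₀, u⟫ - c) =
        ρ * ((⟪y, u⟫ - c) * (⟪x₀, u⟫ - c)) := by
        have : (⟪x, u⟫ : ℝ) = c := by linarith
        rw [this]; ring
      rw [this]; exact h1
  -- near `x`, the folding is by elements fixing `x`
  have hloc : ∀ y, 2 * ‖y - x‖ < δ → ∀ u ∈ W, f y = u (g y) → u (g x) = x := by
    intro y hy u hu hfy
    obtain ⟨k, hk, hkx⟩ := F.orb x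
    have h1 : (u * k⁻¹) x = u (g x) := by
      nth_rewrite 1 [← hfx]
      rw [hkx]; simp [IsometryEquiv.mul_apply]
    rw [← h1]
    refine hδ _ (W.mul_mem hu (W.inv_mem hk)) ?_
    rw [h1]
    have h2 := F.lip A y x
    rw [hfx] at h2
    have h3 : dist (u (g x)) (f y) = dist y x := by
      rw [hfy, u.dist_eq, g.dist_eq, dist_comm]
    have h4 := dist_triangle (u (g x)) (f y) x
    rw [dist_eq_norm y x] at *
    linarith
  set K : Set V := {v | v ∈ D ∧ dist v x = δ / 4 ∧ ∀ e, ((∀ w ∈ W, w x = x → w e = e) ∧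
    (∀ u ∈ W, u (g x) = x → u (g e) = e)) → (⟪v - x, e - x⟫ : ℝ) = 0} with hKd
  have hK : IsCompact K := by
    refine A.cpt.of_isClosed_subset ?_ (fun v hv => hv.1)
    refine A.cpt.isClosed.inter (IsClosed.inter ?_ ?_)
    · exact isClosed_eq (by fun_prop) continuous_const
    · have : ∀ P : V → Prop, IsClosed {v : V | ∀ e, P e → (⟪v - x, e - x⟫ : ℝ) = 0} := by
        intro P
        have h1 : {v : V | ∀ e, P e → (⟪v - x, e - x⟫ : ℝ) = 0} =
            ⋂ e, ⋂ _ : P e, {v : V | (⟪v - x, e - x⟫ : ℝ) = 0} := by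
          ext v; simp
        rw [h1]
        exact isClosed_iInter fun e => isClosed_iInter fun _ =>
          isClosed_eq (by fun_prop) continuous_const
      exact this _
  obtain ⟨v, ⟨hvD, hvd, hvo⟩, hfv⟩ := F.approx A hK (by
    intro ε hε
    obtain ⟨t, ht0, ht1, htε⟩ : ∃ t : ℝ, 0 < t ∧ t ≤ 1 ∧ 8 * (δ / 4) ^ 2 * t ≤ ε ^ 2 := by
      refine ⟨min 1 (ε ^ 2 / (8 * (δ / 4) ^ 2)), by positivity, min_le_left _ _, ?_⟩
      rw [← le_div_iff₀' (by positivity)]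
      exact min_le_right _ _
    obtain ⟨y, hyD, hy⟩ := F.anchor A hq ht0 ht1
    have hy1 : y - x = (1 - t) • (f y - x) + t • (s • b) := by
      nth_rewrite 1 [hy]
      module
    have hle : ‖f y - x‖ ≤ ‖y - x‖ := by
      have := F.lip A y x
      rwa [hfx, dist_eq_norm, dist_eq_norm] at this
    have hyB : ‖y - x‖ ≤ δ / 8 := by
      have h1 : ‖y - x‖ ≤ (1 - t) * ‖f y - x‖ + t * (δ / 8) := by
        nth_rewrite 1 [hy1]
        refine (norm_add_le _ _).trans_eq ?_
        rw [norm_smul, norm_smul t, hB, Real.norm_of_nonneg ht0.le,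
          Real.norm_of_nonneg (by linarith)]
      have h2 : (1 - t) * ‖f y - x‖ ≤ (1 - t) * ‖y - x‖ :=
        mul_le_mul_of_nonneg_left hle (by linarith)
      have h3 : t * ‖y - x‖ ≤ t * (δ / 8) := by linarith
      exact le_of_mul_le_mul_left h3 ht0
    obtain ⟨u, hu, hfy⟩ := F.orb y
    have hux : u (g x) = x := hloc y (by linarith) u hu hfy
    have hkx : (u * g) x = x := hux
    have hky : (u * g) y = f y := hfy.symm
    have heq : ‖f y - x‖ = ‖y - x‖ := by
      rw [← dist_eq_norm, ← dist_eq_norm]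
      nth_rewrite 1 [← hkx]
      rw [← hky]
      exact (u * g).dist_eq _ _
    have hsq : t * (δ / 8) ^ 2 ≤ 2 * ‖y - x‖ ^ 2 := by
      have h1 : ‖y - x‖ ^ 2 = (1 - t) ^ 2 * ‖y - x‖ ^ 2 +
          2 * ((1 - t) * (t * (s * ⟪b, f y - x⟫))) + t ^ 2 * (δ / 8) ^ 2 := by
        nth_rewrite 1 [hy1]
        rw [norm_add_sq_real, norm_smul, norm_smul t, hB, heq, real_inner_smul_left,
          real_inner_smul_right, real_inner_smul_right, mul_pow, mul_pow, Real.norm_eq_abs,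
          Real.norm_eq_abs, sq_abs, sq_abs, real_inner_comm]
      have h2 : 0 ≤ (1 - t) * (t * (s * ⟪b, f y - x⟫)) :=
        mul_nonneg (by linarith) (mul_nonneg ht0.le (mul_nonneg hs.le (hb2 _ (F.mem y))))
      have h3 : t * (t * (δ / 8) ^ 2) ≤ t * (2 * ‖y - x‖ ^ 2) := by
        nlinarith [mul_nonneg (sq_nonneg t) (sq_nonneg ‖y - x‖)]
      exact le_of_mul_le_mul_left h3 ht0
    have hN : 0 < ‖y - x‖ := by
      rcases (norm_nonneg (y - x)).lt_or_eq with h | h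
      · exact h
      · rw [← h] at hsq
        have : 0 < t * (δ / 8) ^ 2 := by positivity
        linarith
    obtain ⟨ρ, hρ0, hρ⟩ : ∃ ρ : ℝ, 0 ≤ ρ ∧ ρ * ‖y - x‖ = δ / 4 :=
      ⟨δ / 4 / ‖y - x‖, by positivity, by field_simp⟩
    have hvD := hscale y hyD ρ hρ0 (by rw [hρ]; linarith)
    have hfv : f (x + ρ • (y - x)) = x + ρ • (f y - x) := by
      have h1 := iso_affine (u * g) hkx y ρ
      rw [hky] at h1
      have h2 := hscale (f y) (F.mem y) ρ hρ0 (by rw [heq, hρ]; linarith)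
      rw [← h1] at h2 ⊢
      exact F.eq_of A hu h2
    refine ⟨x + ρ • (y - x), ⟨hvD, ?_, ?_⟩, ?_⟩
    · rw [dist_eq_norm, add_sub_cancel_left, norm_smul, Real.norm_of_nonneg hρ0, hρ]
    · rintro e ⟨he1, he2⟩
      have h1 : (⟪f y - x, e - x⟫ : ℝ) = ⟪y - x, e - x⟫ := by
        have := inner_iso (u * g) x y e
        rwa [hkx, hky, show (u * g) e = e from he2 u hu hux] at this
      have h2 : (⟪y - x, e - x⟫ : ℝ) = (1 - t) * ⟪y - x, e - x⟫ := by
        nth_rewrite 1 [hy1]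
        rw [inner_add_left, real_inner_smul_left, real_inner_smul_left, real_inner_smul_left,
          hb1 e he1, h1]
        ring
      have h3 : t * (⟪y - x, e - x⟫ : ℝ) = 0 := by linarith
      rw [add_sub_cancel_left, real_inner_smul_left, (mul_eq_zero.1 h3).resolve_left ht0.ne',
        mul_zero]
    · rw [hfv, dist_eq_norm]
      have h1 : x + ρ • (y - x) - (x + ρ • (f y - x)) = (ρ * t) • (s • b - (f y - x)) := by
        have : y - f y = t • (s • b - (f y - x)) := by
          nth_rewrite 1 [hy]
          module
        rw [mul_smul, ← this]
        module
      rw [h1, norm_smul, Real.norm_of_nonneg (by positivity)]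
      have h2 : ‖s • b - (f y - x)‖ ≤ 2 * (δ / 8) := by
        refine (norm_sub_le _ _).trans ?_
        rw [hB, heq]; linarith
      have h3 : 2 * (δ / 4) * t * (δ / 8) ≤ ε * ‖y - x‖ := by
        refine (pow_le_pow_iff_left₀ (by positivity) (by positivity) two_ne_zero).1 ?_
        have := mul_le_mul htε hsq (by positivity) (by positivity)
        nlinarith
      have h4 : ρ * t * ‖s • b - (f y - x)‖ * ‖y - x‖ ≤ ε * ‖y - x‖ := by
        refine le_trans ?_ h3
        calc ρ * t * ‖s • b - (f y - x)‖ * ‖y - x‖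
            = (ρ * ‖y - x‖) * t * ‖s • b - (f y - x)‖ := by ring
          _ ≤ (δ / 4) * t * (2 * (δ / 8)) := by
            rw [hρ]; exact mul_le_mul_of_nonneg_left h2 (by positivity)
          _ = _ := by ring
      exact le_of_mul_le_mul_right h4 hN)
  refine ⟨v, hvD, hfv, ?_, ?_⟩
  · rintro w ⟨hw, hwv⟩
    refine ⟨hw, hδ w hw ?_⟩
    have h1 := dist_triangle (w x) (w v) x
    rw [w.dist_eq, hwv, dist_comm x v, hvd] at h1
    linarith
  · intro hsub
    obtain ⟨k, hk, hkv⟩ := F.orb v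
    have hkx : k (g x) = x := by
      refine hloc v ?_ k hk hkv
      rw [← dist_eq_norm, hvd]; linarith
    have := hvo v ⟨fun w hw hwx => (hsub ⟨hw, hwx⟩).2, fun u hu hux => by
      have h1 : (u * k⁻¹) x = x := by
        nth_rewrite 1 [← hkx]
        simpa [IsometryEquiv.mul_apply] using hux
      have h2 := (hsub ⟨W.mul_mem hu (W.inv_mem hk), h1⟩).2
      rw [hfv] at hkv
      nth_rewrite 1 [hkv] at h2
      simpa [IsometryEquiv.mul_apply] using h2⟩
    rw [inner_self_eq_zero, sub_eq_zero] at this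
    rw [this, dist_self] at hvd
    linarith

theorem Fold.exists_int [FiniteDimensional ℝ V] (A : Ax W D x₀) (F : Fold W D g f) :
    ∃ x ∈ interior D, f x = x := by
  have key : ∀ n : ℕ, ∀ x ∈ D, f x = x → {w : V ≃ᵢ V | w ∈ W ∧ w x = x}.ncard = n →
      ∃ x ∈ interior D, f x = x := by
    intro n
    induction n using Nat.strong_induction_on with
    | _ n ih =>
      intro x hx hfx hn
      by_cases hi : x ∈ interior D
      · exact ⟨x, hi, hfx⟩
      · obtain ⟨v, hv, hfv, hss⟩ := F.step A hx hfx hi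
        refine ih _ ?_ v hv hfv rfl
        rw [← hn]
        refine Set.ncard_lt_ncard hss ((A.hpd {x} isCompact_singleton).subset ?_)
        rintro w ⟨hw, h⟩
        exact ⟨hw, x, rfl, h⟩
  obtain ⟨x, hx, hfx⟩ := F.exists_fixed A
  exact key _ x hx hfx rfl

end FixPt

/-- Fixed point lemma (Euclidean case): for every isometry `g` of `V` there is a unique
`w ∈ W` such that `w⁻¹ ∘ g` has a fixed point in `D°`. -/
theorem exists_unique_fixed_point_affine {V : Type*} [NormedAddCommGroup V]
    [InnerProductSpace ℝ V] [FiniteDimensional ℝ V]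
    (W : Subgroup (V ≃ᵢ V)) (D : Set V)
    (hWgen : Subgroup.closure {g : V ≃ᵢ V | g ∈ W ∧ IsAffRefl g} = W)
    (hlf : LocallyFinite fun g : {g : V ≃ᵢ V // g ∈ W ∧ IsAffRefl g} => {x : V | g.1 x = x})
    (hpd : ∀ K : Set V, IsCompact K → {g : V ≃ᵢ V | g ∈ W ∧ ∃ x ∈ K, g x ∈ K}.Finite)
    (hD : ∃ x₀ ∈ (affMirrors W)ᶜ, D = closure (connectedComponentIn (affMirrors W)ᶜ x₀))
    (hDcpt : IsCompact D)
    (hcover : ∀ v : V, ∃ w ∈ W, ∃ x ∈ D, w x = v)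
    (hdisj : ∀ w ∈ W, ∀ w' ∈ W, w ≠ w' →
      ∀ x ∈ interior D, ∀ x' ∈ interior D, w x ≠ w' x')
    (g : V ≃ᵢ V) :
    (∃ w ∈ W, ∃ x ∈ interior D, g x = w x) ∧
    (∀ w₁ ∈ W, ∀ w₂ ∈ W, ∀ x₁ ∈ interior D, ∀ x₂ ∈ interior D,
      g x₁ = w₁ x₁ → g x₂ = w₂ x₂ → w₁ = w₂) := by

  obtain ⟨x₀, A⟩ := FixPt.mk_ax W D hlf hpd hD hDcpt hcover hdisj
  constructor
  · obtain ⟨f, F⟩ := A.exists_fold g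
    obtain ⟨x, hx, hfx⟩ := F.exists_int A
    obtain ⟨u, hu, hux⟩ := F.orb x
    refine ⟨u⁻¹, W.inv_mem hu, x, hx, ?_⟩
    rw [hfx] at hux
    nth_rewrite 2 [hux]
    simp
  · intro w₁ h₁ w₂ h₂ x₁ hx₁ x₂ hx₂ e₁ e₂
    have h := A.unique hx₁ hx₂ (W.mul_mem (W.inv_mem h₁) h₂) (by
      have h3 : dist (g x₁) (g x₂) = dist x₁ x₂ := g.dist_eq _ _
      rw [← h3, e₁, e₂, ← w₁.dist_eq x₁]
      simp [IsometryEquiv.mul_apply])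
    exact (inv_mul_eq_one.1 h)
end
end

section
/- Let g : V → V be a continuous map. Then there exist w ∈ W and x ∈ D with g x = w x. Moreover, if g is 1-Lipschitz (dist(g x₁, g x₂) ≤ dist(x₁, x₂) for all x₁, x₂ ∈ V) and g x = w x holds for some x ∈ D°, then w is the unique element of W for which w⁻¹ ∘ g has a fixed point in D°. -/
open scoped RealInnerProductSpace

noncomputable section

section Brouwer
variable {V : Type*} [NormedAddCommGroup V] [InnerProductSpace ℝ V] [FiniteDimensional ℝ V]

theorem det_poly (A : V →L[ℝ] V) : ∃ p : Polynomial ℝ, p.natDegree ≤ Module.finrank ℝ V ∧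
    ∀ t : ℝ, p.eval t = (ContinuousLinearMap.id ℝ V + t • A).det := by
  classical
  let b := Module.finBasis ℝ V
  let M := LinearMap.toMatrix b b (A : V →ₗ[ℝ] V)
  refine ⟨Matrix.det ((Polynomial.X : Polynomial ℝ) • M.map Polynomial.C +
    (1 : Matrix _ _ ℝ).map Polynomial.C), ?_, fun t => ?_⟩
  · simpa using Polynomial.natDegree_det_X_add_C_le M 1
  · rw [← Polynomial.coe_evalRingHom, RingHom.map_det]
    change _ = LinearMap.det ((ContinuousLinearMap.id ℝ V + t • A : V →L[ℝ] V) : V →ₗ[ℝ] V)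
    rw [← LinearMap.det_toMatrix b]
    congr 1
    ext i j
    have e : ((ContinuousLinearMap.id ℝ V + t • A : V →L[ℝ] V) : V →ₗ[ℝ] V)
      = LinearMap.id + t • (A : V →ₗ[ℝ] V) := rfl
    have e2 : LinearMap.toMatrix b b (LinearMap.id + t • (A : V →ₗ[ℝ] V)) = 1 + t • M := by
      rw [LinearEquiv.map_add, LinearEquiv.map_smul, LinearMap.toMatrix_id]
    rw [e, e2]
    simp only [RingHom.mapMatrix_apply, Matrix.map_apply, Matrix.add_apply, Matrix.smul_apply,
      Matrix.one_apply, Polynomial.coe_evalRingHom, Polynomial.eval_add, smul_eq_mul,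
      Polynomial.eval_mul, Polynomial.eval_X, Polynomial.eval_C]
    ring

theorem det_pos_of_small (A : V →L[ℝ] V) (hA : ‖A‖ < 1) :
    0 < (ContinuousLinearMap.id ℝ V + A).det := by
  have hne : ∀ s ∈ Set.Icc (0:ℝ) 1, (ContinuousLinearMap.id ℝ V + s • A).det ≠ 0 := by
    intro s hs h0
    have := LinearMap.bot_lt_ker_of_det_eq_zero (f := 
      ((ContinuousLinearMap.id ℝ V + s • A : V →L[ℝ] V) : V →ₗ[ℝ] V)) h0
    obtain ⟨v, hv, hv0⟩ := Submodule.exists_mem_ne_zero_of_ne_bot this.ne'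
    have hv : v + s • A v = 0 := hv
    have h1 : ‖v‖ = s * ‖A v‖ := by
      rw [eq_neg_of_add_eq_zero_left hv, norm_neg, norm_smul, Real.norm_of_nonneg hs.1,
        ← eq_neg_of_add_eq_zero_left hv]
    have h2 := A.le_opNorm v
    have h3 : 0 < ‖v‖ := norm_pos_iff.2 hv0
    have h4 : s * ‖A v‖ ≤ 1 * ‖A v‖ := by gcongr; exact hs.2
    nlinarith
  by_contra hcon
  have hcont : ContinuousOn (fun s : ℝ => (ContinuousLinearMap.id ℝ V + s • A).det) 
      (Set.Icc 0 1) :=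
    (ContinuousLinearMap.continuous_det.comp (by fun_prop)).continuousOn
  have := intermediate_value_Icc' zero_le_one hcont
  have h0 : (0:ℝ) ∈ Set.Icc ((ContinuousLinearMap.id ℝ V + (1:ℝ) • A).det) 
    ((ContinuousLinearMap.id ℝ V + (0:ℝ) • A).det) := by
    refine ⟨by simpa using hcon, ?_⟩
    simp [ContinuousLinearMap.det]
  obtain ⟨s, hs, hs0⟩ := this h0
  exact hne s hs hs0

theorem lipschitz_extend (φ : V → V) (R : ℝ) (L : NNReal)
    (hφ : LipschitzOnWith L φ (Metric.closedBall 0 R))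
    (h0 : ∀ x, ‖x‖ = R → φ x = 0) :
    LipschitzWith L ((Metric.closedBall (0:V) R).indicator φ) := by
  classical
  have key : ∀ x y : V, ‖x‖ ≤ R → R < ‖y‖ → dist (φ x) 0 ≤ L * dist x y := by
    intro x y hx hy
    have hc : ContinuousOn (fun t : ℝ => ‖x + t • (y - x)‖) (Set.Icc 0 1) := by fun_prop
    have := intermediate_value_Icc zero_le_one hc
    obtain ⟨t, ht, hte⟩ := this (show R ∈ _ from ⟨by simpa using hx, by simpa using hy.le⟩)
    rw [← h0 _ hte]
    refine (hφ.dist_le_mul x (by simpa using hx) _ (by simpa using hte.le)).trans ?_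
    gcongr
    rw [dist_self_add_right, norm_smul, Real.norm_of_nonneg ht.1, dist_comm, dist_eq_norm]
    exact mul_le_of_le_one_left (norm_nonneg _) ht.2
  apply LipschitzWith.of_dist_le_mul
  intro x y
  by_cases hx : ‖x‖ ≤ R <;> by_cases hy : ‖y‖ ≤ R <;> simp only [Set.indicator_apply, 
    mem_closedBall_zero_iff, hx, hy, if_true, if_false]
  · exact hφ.dist_le_mul x (by simpa using hx) y (by simpa using hy)
  · exact key x y hx (not_le.1 hy)
  · rw [dist_comm, dist_comm x]; exact key y x hy (not_le.1 hx)
  · simp; positivity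

open MeasureTheory in
theorem no_retraction [MeasurableSpace V] [BorelSpace V] (φ : V → V) (R : ℝ) (hR : 0 < R)
    (hφ : ∀ x, ‖x‖ ≤ R → ContDiffAt ℝ 1 φ x)
    (h0 : ∀ x, ‖x‖ = R → φ x = 0)
    (h1 : ∀ x, ‖x‖ ≤ R → ‖x + φ x‖ = R) : False := by
  have hfc : ContinuousOn (fderiv ℝ φ) (Metric.closedBall 0 R) := fun x hx =>
    ((hφ x (by simpa using hx)).continuousAt_fderiv one_ne_zero).continuousWithinAt
  have hd : ∀ x, ‖x‖ ≤ R → DifferentiableAt ℝ φ x := fun x hx =>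
    (hφ x hx).differentiableAt one_ne_zero
  obtain ⟨L0, hL0⟩ := (isCompact_closedBall (0:V) R).exists_bound_of_continuousOn hfc
  set L : NNReal := L0.toNNReal with hLdef
  have hL : ∀ x ∈ Metric.closedBall (0:V) R, ‖fderiv ℝ φ x‖ ≤ L := fun x hx =>
    (hL0 x hx).trans (Real.le_coe_toNNReal _)
  have hlip : LipschitzOnWith L φ (Metric.closedBall 0 R) :=
    (convex_closedBall (0:V) R).lipschitzOnWith_of_nnnorm_fderiv_le 
      (fun x hx => hd x (by simpa using hx)) hL
  have hext := lipschitz_extend φ R L hlip h0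
  set ψ := (Metric.closedBall (0:V) R).indicator φ with hψ
  let B := Metric.ball (0:V) R
  -- integrability
  have hint : ∀ t : ℝ, IntegrableOn (fun x => (ContinuousLinearMap.id ℝ V + t • fderiv ℝ φ x).det)
      B volume := by
    intro t
    have : ContinuousOn (fun x => (ContinuousLinearMap.id ℝ V + t • fderiv ℝ φ x).det) 
      (Metric.closedBall 0 R) :=
      ContinuousLinearMap.continuous_det.comp_continuousOn (by fun_prop)
    exact (this.integrableOn_compact (isCompact_closedBall _ _)).mono_set Metric.ball_subset_closedBall
  -- small t
  have hsmall : ∀ t : ℝ, 0 ≤ t → t < 1 → t * L < 1 → 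
      ∫ x in B, (ContinuousLinearMap.id ℝ V + t • fderiv ℝ φ x).det = volume.real B := by
    intro t ht0 ht1 htL
    let h : V → V := fun x => x + t • φ x
    have hinj : Set.InjOn h B := by
      intro x hx y hy hxy
      have hxy : x + t • φ x = y + t • φ y := hxy
      by_contra hne
      have hpos : 0 < dist x y := dist_pos.2 hne
      have e : x - y = t • (φ y - φ x) := by
        rw [smul_sub, sub_eq_sub_iff_add_eq_add, hxy, add_comm]
      have e2 : dist x y = t * dist (φ y) (φ x) := by
        rw [dist_eq_norm, e, norm_smul, Real.norm_of_nonneg ht0, dist_eq_norm]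
      have e3 := hlip.dist_le_mul y (Metric.ball_subset_closedBall hy) x 
        (Metric.ball_subset_closedBall hx)
      rw [dist_comm y x] at e3
      have := mul_le_mul_of_nonneg_left e3 ht0
      nlinarith
    have himg : h '' B = B := by
      apply Set.Subset.antisymm
      · rintro _ ⟨x, hx, rfl⟩
        have hx' : ‖x‖ < R := by simpa [B] using hx
        have e : h x = (1 - t) • x + t • (x + φ x) := by
          simp only [h]; module
        have : ‖h x‖ ≤ (1 - t) * ‖x‖ + t * R := by
          rw [e]
          refine (norm_add_le _ _).trans ?_
          rw [norm_smul, norm_smul, Real.norm_of_nonneg ht0, Real.norm_of_nonneg (by linarith),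
            h1 x hx'.le]
        simp only [B, mem_ball_zero_iff]
        nlinarith
      · intro y hy
        have hy' : ‖y‖ < R := by simpa [B] using hy
        have hcontr : ContractingWith (Real.toNNReal t * L) (fun x => y - t • ψ x) := by
          refine ⟨?_, ?_⟩
          · rw [← NNReal.coe_lt_coe]; simpa [ht0] using htL
          · apply LipschitzWith.of_dist_le_mul
            intro a b
            rw [dist_sub_left, dist_smul₀, Real.norm_of_nonneg ht0]
            simp only [NNReal.coe_mul, Real.coe_toNNReal _ ht0]
            rw [mul_assoc]
            gcongr
            exact hext.dist_le_mul a b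
        have hfix : y - t • ψ (hcontr.fixedPoint _) = hcontr.fixedPoint _ := 
          hcontr.fixedPoint_isFixedPt
        set x := hcontr.fixedPoint _
        by_cases hx : ‖x‖ < R
        · refine ⟨x, by simpa [B] using hx, ?_⟩
          have : ψ x = φ x := Set.indicator_of_mem (by simpa using hx.le) _
          rw [this] at hfix
          simp only [h]
          nth_rewrite 1 [← hfix]
          abel
        · exfalso
          have : ψ x = 0 := by
            by_cases hx2 : ‖x‖ ≤ R
            · rw [hψ, Set.indicator_of_mem (by simpa using hx2)]
              exact h0 x (le_antisymm hx2 (not_lt.1 hx))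
            · rw [hψ, Set.indicator_of_notMem (by simpa using hx2)]
          rw [this, smul_zero, sub_zero] at hfix
          rw [← hfix] at hx
          exact hx hy'
    have hder : ∀ x ∈ B, HasFDerivWithinAt h (ContinuousLinearMap.id ℝ V + t • fderiv ℝ φ x) B x := by
      intro x hx
      have hx' : ‖x‖ < R := by simpa [B] using hx
      exact ((hasFDerivAt_id x).add ((hd x hx'.le).hasFDerivAt.const_smul t)).hasFDerivWithinAt
    have hcov := integral_image_eq_integral_abs_det_fderiv_smul volume measurableSet_ball hder hinj
      (fun _ => (1:ℝ))
    rw [himg] at hcov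
    simp only [smul_eq_mul, mul_one, integral_const, measureReal_restrict_apply_univ] at hcov
    rw [hcov]
    apply setIntegral_congr_fun measurableSet_ball
    intro x hx
    have hx' : x ∈ Metric.closedBall (0:V) R := Metric.ball_subset_closedBall hx
    refine (abs_of_pos (det_pos_of_small _ ?_)).symm
    rw [norm_smul, Real.norm_of_nonneg ht0]
    exact (mul_le_mul_of_nonneg_left (hL x hx') ht0).trans_lt htL
  -- interpolation
  let n := Module.finrank ℝ V
  let s := Finset.range (n + 1)
  let v : ℕ → ℝ := fun i => 1 / ((L + 1) * (i + 2))
  have hLnn : (0:ℝ) ≤ L := L.2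
  have hv : Set.InjOn v s := by
    intro i _ j _ hij
    simp only [v] at hij
    have hi : 0 < ((L:ℝ) + 1) * (i + 2) := by positivity
    have hj : 0 < ((L:ℝ) + 1) * (j + 2) := by positivity
    rw [div_eq_div_iff hi.ne' hj.ne', one_mul, one_mul] at hij
    have h3 := mul_left_cancel₀ (by positivity : ((L:ℝ) + 1) ≠ 0) hij
    have h4 : (i:ℝ) = j := by linarith
    exact_mod_cast h4
  have hinterp : ∀ x, (ContinuousLinearMap.id ℝ V + (1:ℝ) • fderiv ℝ φ x).det = 
      ∑ i ∈ s, (ContinuousLinearMap.id ℝ V + v i • fderiv ℝ φ x).det * 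
        (Lagrange.basis s v i).eval 1 := by
    intro x
    obtain ⟨p, hp, hpe⟩ := det_poly (fderiv ℝ φ x)
    have hdeg : p.degree < s.card := by
      refine (Polynomial.degree_le_natDegree).trans_lt ?_
      simp only [s, Finset.card_range]
      exact_mod_cast Nat.lt_succ_of_le hp
    have := congrArg (Polynomial.eval 1) (Lagrange.eq_interpolate hv hdeg)
    rw [Lagrange.interpolate_apply, Polynomial.eval_finsetSum] at this
    simpa [hpe] using this
  have hsum1 : ∑ i ∈ s, (Lagrange.basis s v i).eval 1 = 1 := by
    rw [← Polynomial.eval_finsetSum, Lagrange.sum_basis hv ⟨0, by simp [s]⟩]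
    simp
  have hone : ∫ x in B, (ContinuousLinearMap.id ℝ V + (1:ℝ) • fderiv ℝ φ x).det 
      = volume.real B := by
    simp_rw [hinterp]
    rw [integral_finsetSum _ (fun i _ => (hint (v i)).mul_const _)]
    simp_rw [integral_mul_const]
    have : ∀ i ∈ s, (∫ x in B, (ContinuousLinearMap.id ℝ V + v i • fderiv ℝ φ x).det) * 
        (Lagrange.basis s v i).eval 1 = volume.real B * (Lagrange.basis s v i).eval 1 := by
      intro i _
      have hden : 0 < ((L:ℝ) + 1) * (i + 2) := by positivity
      rw [hsmall (v i) (by positivity)]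
      · rw [div_lt_one hden]; nlinarith [(Nat.cast_nonneg i : (0:ℝ) ≤ i)]
      · rw [div_mul_eq_mul_div, div_lt_one hden]; nlinarith [(Nat.cast_nonneg i : (0:ℝ) ≤ i)]
    rw [Finset.sum_congr rfl this, ← Finset.mul_sum, hsum1, mul_one]
  have hzero : ∫ x in B, (ContinuousLinearMap.id ℝ V + (1:ℝ) • fderiv ℝ φ x).det = 0 := by
    apply setIntegral_eq_zero_of_forall_eq_zero
    intro x hx
    have hx' : ‖x‖ < R := by simpa [B] using hx
    set T := ContinuousLinearMap.id ℝ V + (1:ℝ) • fderiv ℝ φ x with hT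
    have hder : HasFDerivAt (fun x => x + φ x) T x := by
      rw [hT, one_smul]
      exact (hasFDerivAt_id x).add (hd x hx'.le).hasFDerivAt
    have hn := hder.norm_sq
    have hc : (fun y => ‖y + φ y‖ ^ 2) =ᶠ[nhds x] fun _ => R ^ 2 := by
      filter_upwards [Metric.isOpen_ball.mem_nhds hx] with y hy
      rw [h1 y (by simpa using (mem_ball_zero_iff.1 hy).le)]
    have hn2 := (hasFDerivAt_const (𝕜 := ℝ) (R^2) x).congr_of_eventuallyEq hc
    have huniq := hn.unique hn2
    have horth : ∀ v, ⟪x + φ x, T v⟫ = 0 := by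
      intro v
      have := DFunLike.congr_fun huniq v
      simp at this
      rw [inner_add_left]
      linarith
    by_contra hdet
    have hsurj : Function.Surjective (T : V →ₗ[ℝ] V) := by
      have : IsUnit (LinearMap.det (T : V →ₗ[ℝ] V)) := isUnit_iff_ne_zero.2 hdet
      exact (LinearEquiv.ofIsUnitDet (f := (T : V →ₗ[ℝ] V)) (v := Module.finBasis ℝ V) (v' := Module.finBasis ℝ V) (by simpa using this)).surjective
    obtain ⟨v, hv⟩ := hsurj (x + φ x)
    have := horth v
    rw [show T v = x + φ x from hv, real_inner_self_eq_norm_sq, h1 x hx'.le] at this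
    nlinarith
  have hvol : 0 < volume.real B := by
    rw [Measure.real, ENNReal.toReal_pos_iff]
    exact ⟨Metric.measure_ball_pos _ _ hR, measure_ball_lt_top⟩
  linarith

theorem brouwer_smooth (g : V → V) (hg : ContDiff ℝ 1 g) (R : ℝ) (hR : 0 < R)
    (hb : ∀ x, ‖g x‖ < R) : ∃ x, g x = x := by
  by_contra! hne
  let _ :  MeasurableSpace V := borel V
  have : BorelSpace V := ⟨rfl⟩
  let u : V → V := fun x => x - g x
  let A : V → ℝ := fun x => ⟪u x, u x⟫
  let b : V → ℝ := fun x => ⟪x, u x⟫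
  let d : V → ℝ := fun x => b x ^ 2 + A x * (R ^ 2 - ‖x‖ ^ 2)
  let l : V → ℝ := fun x => (- b x + √(d x)) / A x
  have hA : ∀ x, 0 < A x := fun x => real_inner_self_pos.2 (sub_ne_zero.2 (hne x).symm)
  have hu : ContDiff ℝ 1 u := contDiff_id.sub hg
  have hAc : ContDiff ℝ 1 A := hu.inner ℝ hu
  have hbc : ContDiff ℝ 1 b := contDiff_id.inner ℝ hu
  have hdc : ContDiff ℝ 1 d := 
    (hbc.pow 2).add (hAc.mul (contDiff_const.sub (contDiff_norm_sq ℝ)))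
  have hbpos : ∀ x, ‖x‖ = R → 0 < b x := by
    intro x hx
    have : b x = ‖x‖ ^ 2 - ⟪x, g x⟫ := by
      simp only [b, u, inner_sub_right, real_inner_self_eq_norm_sq]
    have h2 := real_inner_le_norm x (g x)
    have := hb x
    rw [hx] at *
    nlinarith
  have hdpos : ∀ x, ‖x‖ ≤ R → 0 < d x := by
    intro x hx
    rcases hx.lt_or_eq with h | h
    · have : 0 < R ^ 2 - ‖x‖ ^ 2 := by nlinarith [norm_nonneg x]
      have := mul_pos (hA x) this
      simp only [d]; positivity
    · have := hbpos x h
      simp only [d, h, sub_self, mul_zero, add_zero]; positivity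
  apply no_retraction (fun x => l x • u x) R hR
  · intro x hx
    exact ((hbc.contDiffAt.neg.add (hdc.contDiffAt.sqrt (hdpos x hx).ne')).div hAc.contDiffAt
      (hA x).ne').smul hu.contDiffAt
  · intro x hx
    have : l x = 0 := by
      simp [l, d, hx, Real.sqrt_sq (hbpos x hx).le]
    simp [this]
  · intro x hx
    have hs := Real.sq_sqrt (hdpos x hx).le
    have hl : l x * A x = - b x + √(d x) := div_mul_cancel₀ _ (hA x).ne'
    have : ‖x + l x • u x‖ ^ 2 = R ^ 2 := by
      rw [norm_add_sq_real, inner_smul_right, norm_smul, mul_pow, ← real_inner_self_eq_norm_sq (u x)]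
      change ‖x‖ ^ 2 + 2 * (l x * b x) + ‖l x‖ ^ 2 * A x = R ^ 2
      rw [Real.norm_eq_abs, sq_abs]
      have hd : d x = b x ^ 2 + A x * (R ^ 2 - ‖x‖ ^ 2) := rfl
      apply mul_left_cancel₀ (hA x).ne'
      linear_combination (2 * b x + l x * A x - b x + √(d x)) * hl + hs + hd
    exact (pow_left_inj₀ (norm_nonneg _) hR.le two_ne_zero).1 this

theorem brouwer_bounded (f : V → V) (hf : Continuous f) (R : ℝ) (hb : ∀ x, ‖f x‖ ≤ R) :
    ∃ x, f x = x := by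
  by_contra! hne
  have hR : 0 ≤ R := (norm_nonneg _).trans (hb 0)
  obtain ⟨x₀, -, hmin⟩ := (isCompact_closedBall (0:V) (R+1)).exists_isMinOn 
    ⟨0, by simp; linarith⟩ (f := fun x => dist (f x) x) (hf.dist continuous_id).continuousOn
  have hδ : 0 < dist (f x₀) x₀ := dist_pos.2 (hne x₀)
  obtain ⟨g, hg, hgf, -⟩ := hf.exists_contDiff_approx 1 (ε := fun _ => min (dist (f x₀) x₀) 1)
    continuous_const (fun _ => lt_min hδ one_pos)
  have hgb : ∀ x, ‖g x‖ < R + 1 := by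
    intro x
    have h1 := (hgf x).trans_le (min_le_right _ _)
    rw [dist_eq_norm] at h1
    have := norm_le_norm_add_norm_sub' (g x) (f x)
    linarith [hb x]
  obtain ⟨x, hx⟩ := brouwer_smooth g (by exact_mod_cast hg) (R+1) (by linarith) hgb
  have h1 := (hgf x).trans_le (min_le_left _ _)
  have h2 : dist (f x₀) x₀ ≤ dist (f x) x := hmin (by simpa [hx] using (hgb x).le)
  rw [hx, dist_comm] at h1
  linarith
end Brouwer

theorem refl_norm {V : Type*} [NormedAddCommGroup V] [InnerProductSpace ℝ V]
    (u x y : V) (c : ℝ) (hu : u ≠ 0) 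
    (h : dist x y ≤ dist x (y - ((2 * (⟪y, u⟫ - c)) / ⟪u, u⟫) • u)) :
    0 ≤ (⟪x, u⟫ - c) * (⟪y, u⟫ - c) := by
  have hu2 : 0 < ⟪u, u⟫ := real_inner_self_pos.2 hu
  rw [dist_eq_norm, dist_eq_norm] at h
  have h2 := mul_self_le_mul_self (norm_nonneg _) h
  rw [← real_inner_self_eq_norm_mul_norm, ← real_inner_self_eq_norm_mul_norm] at h2
  have e : x - (y - ((2 * (⟪y, u⟫ - c)) / ⟪u, u⟫) • u)
    = (x - y) + ((2 * (⟪y, u⟫ - c)) / ⟪u, u⟫) • u := by abel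
  rw [e, inner_add_add_self, inner_smul_right, inner_smul_left, inner_smul_left, inner_smul_right,
    inner_sub_left x y u, real_inner_comm (x-y) u, inner_sub_left x y u] at h2
  simp only [conj_trivial] at h2
  set a := ⟪x, u⟫
  set b := ⟪y, u⟫
  set n := ⟪u, u⟫
  have h3 : 0 ≤ (2 * (b - c) / n) * (2 * (a - b) + (2 * (b-c) / n) * n) := by nlinarith
  rw [div_mul_cancel₀ _ hu2.ne'] at h3
  have h4 : (2 * (b - c) / n) * (2 * (a - b) + 2 * (b-c)) = 4 * ((a-c)*(b-c)) / n := by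
    field_simp; ring
  rw [h4] at h3
  have := mul_nonneg h3 hu2.le
  rw [div_mul_cancel₀ _ hu2.ne'] at this
  linarith

theorem mirror_iff {V : Type*} [NormedAddCommGroup V] [InnerProductSpace ℝ V]
    {g : V ≃ᵢ V} {u : V} {c : ℝ} (hu : u ≠ 0)
    (h : ∀ x : V, g x = x - ((2 * (⟪x, u⟫ - c)) / ⟪u, u⟫) • u) (x : V) :
    g x = x ↔ ⟪x, u⟫ - c = 0 := by
  have hu2 : ⟪u, u⟫ ≠ 0 := (real_inner_self_pos.2 hu).ne'
  rw [h, sub_eq_self, smul_eq_zero]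
  simp [hu]

section Chamber
variable {V : Type*} [NormedAddCommGroup V] [InnerProductSpace ℝ V] [FiniteDimensional ℝ V]
    (W : Subgroup (V ≃ᵢ V)) 

theorem isClosed_affMirrors 
    (hlf : LocallyFinite fun g : {g : V ≃ᵢ V // g ∈ W ∧ IsAffRefl g} => {x : V | g.1 x = x}) :
    IsClosed (affMirrors W) := by
  have := hlf.isClosed_iUnion (fun i => isClosed_eq i.1.continuous continuous_id)
  convert this using 1
  ext x; simp [affMirrors]

/-- points weakly on the same side as `x` of every mirror lie in the closed chamber -/
theorem mem_closure_chamber (x₀ x y : V) (hx : x ∈ connectedComponentIn (affMirrors W)ᶜ x₀)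
    (h : ∀ s ∈ W, ∀ (u : V) (c : ℝ), u ≠ 0 → 
      (∀ x : V, s x = x - ((2 * (⟪x, u⟫ - c)) / ⟪u, u⟫) • u) → 
      0 ≤ (⟪x, u⟫ - c) * (⟪y, u⟫ - c)) :
    y ∈ closure (connectedComponentIn (affMirrors W)ᶜ x₀) := by
  have hxm : x ∉ affMirrors W := connectedComponentIn_subset _ _ hx
  rw [connectedComponentIn_eq hx]
  -- half open segment
  let γ : ℝ → V := fun t => x + t • (y - x)
  have hγ : Continuous γ := by fun_prop
  have hsub : γ '' Set.Ico 0 1 ⊆ connectedComponentIn (affMirrors W)ᶜ x := by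
    apply IsPreconnected.subset_connectedComponentIn
    · exact (isPreconnected_Ico).image _ hγ.continuousOn
    · exact ⟨0, by simp, by simp [γ]⟩
    · rintro _ ⟨t, ht, rfl⟩ hm
      simp only [affMirrors, Set.mem_iUnion, Set.mem_ofPred_eq, exists_prop] at hm hxm
      obtain ⟨s, ⟨hs, u, c, hu, hsu⟩, hfix⟩ := hm
      rw [mirror_iff hu hsu] at hfix
      have hne : ⟪x, u⟫ - c ≠ 0 := fun h0 => hxm ⟨s, ⟨hs, u, c, hu, hsu⟩, (mirror_iff hu hsu x).2 h0⟩
      have hh := h s hs u c hu hsu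
      simp only [γ, inner_add_left, inner_smul_left, inner_sub_left, conj_trivial] at hfix
      set a := ⟪x, u⟫
      set b := ⟪y, u⟫
      have h1 : (1 - t) * (a - c) + t * (b - c) = 0 := by linarith
      have h2 : (1 - t) * ((a - c) * (a-c)) + t * ((a-c) * (b - c)) = 0 := by
        linear_combination (a-c) * h1
      have h3 : 0 < (a-c)*(a-c) := mul_self_pos.2 hne
      have h4 := mul_pos (sub_pos.2 ht.2) h3
      have h5 := mul_nonneg ht.1 hh
      linarith
  apply closure_mono hsub
  have : (1:ℝ) ∈ closure (Set.Ico (0:ℝ) 1) := by rw [closure_Ico (by norm_num)]; simp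
  have := image_closure_subset_closure_image hγ (Set.mem_image_of_mem γ this)
  simpa [γ] using this

theorem dist_le_orbit (D : Set V)
    (hlf : LocallyFinite fun g : {g : V ≃ᵢ V // g ∈ W ∧ IsAffRefl g} => {x : V | g.1 x = x})
    (hpd : ∀ K : Set V, IsCompact K → {g : V ≃ᵢ V | g ∈ W ∧ ∃ x ∈ K, g x ∈ K}.Finite)
    (hD : ∃ x₀ ∈ (affMirrors W)ᶜ, D = closure (connectedComponentIn (affMirrors W)ᶜ x₀))
    (hdisj : ∀ w ∈ W, ∀ w' ∈ W, w ≠ w' →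
      ∀ x ∈ interior D, ∀ x' ∈ interior D, w x ≠ w' x')
    (x y : V) (hx : x ∈ D) (hy : y ∈ D) (w : V ≃ᵢ V) (hw : w ∈ W) :
    dist x y ≤ dist x (w y) := by
  obtain ⟨x₀, hx₀, hDe⟩ := hD
  set C := connectedComponentIn (affMirrors W)ᶜ x₀ with hC
  have hCo : IsOpen C := (isClosed_affMirrors W hlf).isOpen_compl.connectedComponentIn
  have hCD : C ⊆ interior D := by
    rw [hDe]; exact interior_maximal subset_closure hCo
  have key : ∀ x ∈ C, ∀ y ∈ C, dist x y ≤ dist x (w y) := by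
    intro x hx y hy
    have hfin := hpd (Metric.closedBall x (dist x y)) (isCompact_closedBall _ _)
    let S : Set (V ≃ᵢ V) := {g | g ∈ W ∧ dist x (g y) ≤ dist x y}
    have hS : S.Finite := hfin.subset (by
      rintro g ⟨hg, hg2⟩
      refine ⟨hg, y, ?_, ?_⟩
      · simp [dist_comm]
      · simpa [dist_comm] using hg2)
    have h1S : (1 : V ≃ᵢ V) ∈ S := ⟨W.one_mem, by simp⟩
    obtain ⟨w₀, hw₀, hmin⟩ := Set.exists_min_image S (fun g => dist x (g y)) hS ⟨1, h1S⟩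
    have hmin' : ∀ g ∈ W, dist x (w₀ y) ≤ dist x (g y) := by
      intro g hg
      by_cases h : dist x (g y) ≤ dist x y
      · exact hmin g ⟨hg, h⟩
      · exact hw₀.2.trans (not_le.1 h).le
    have hmem : w₀ y ∈ closure C := by
      apply mem_closure_chamber W x₀ x _ hx
      intro s hs u c hu hsu
      apply refl_norm u x _ c hu
      rw [← hsu]
      exact hmin' (s * w₀) (W.mul_mem hs hw₀.1)
    have hone : w₀ = 1 := by
      by_contra hne
      have hnb : w₀ '' (interior D) ∈ nhds (w₀ y) :=
        (w₀.toHomeomorph.isOpenMap _ isOpen_interior).mem_nhds ⟨y, hCD hy, rfl⟩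
      obtain ⟨z, ⟨z', hz', hzz⟩, hzC⟩ := mem_closure_iff_nhds.1 hmem _ hnb
      exact hdisj w₀ hw₀.1 1 W.one_mem hne z' hz' z (hCD hzC) (by simpa using hzz)
    have := hmin' w hw
    simpa [hone] using this
  have hcl : IsClosed {p : V × V | dist p.1 p.2 ≤ dist p.1 (w p.2)} :=
    isClosed_le (by fun_prop) 
      (continuous_fst.dist (w.continuous.comp continuous_snd))
  have : closure (C ×ˢ C) ⊆ {p : V × V | dist p.1 p.2 ≤ dist p.1 (w p.2)} :=
    closure_minimal (fun p hp => key _ hp.1 _ hp.2) hcl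
  rw [closure_prod_eq, ← hDe] at this
  exact this (Set.mk_mem_prod hx hy)

theorem exists_fold (D : Set V)
    (hlf : LocallyFinite fun g : {g : V ≃ᵢ V // g ∈ W ∧ IsAffRefl g} => {x : V | g.1 x = x})
    (hpd : ∀ K : Set V, IsCompact K → {g : V ≃ᵢ V | g ∈ W ∧ ∃ x ∈ K, g x ∈ K}.Finite)
    (hD : ∃ x₀ ∈ (affMirrors W)ᶜ, D = closure (connectedComponentIn (affMirrors W)ᶜ x₀))
    (hdisj : ∀ w ∈ W, ∀ w' ∈ W, w ≠ w' →
      ∀ x ∈ interior D, ∀ x' ∈ interior D, w x ≠ w' x')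
    (hcover : ∀ v : V, ∃ w ∈ W, ∃ x ∈ D, w x = v) :
    ∃ r : V → V, Continuous r ∧ ∀ v, r v ∈ D ∧ ∃ w ∈ W, w (r v) = v := by
  choose w hw r hr hwr using hcover
  refine ⟨r, ?_, fun v => ⟨hr v, w v, hw v, hwr v⟩⟩
  have : LipschitzWith 1 r := by
    apply LipschitzWith.of_dist_le_mul
    intro a b
    have h := dist_le_orbit W D hlf hpd hD hdisj (r a) (r b) (hr a) (hr b) ((w a)⁻¹ * w b)
      (W.mul_mem (W.inv_mem (hw a)) (hw b))
    have e : dist (r a) (((w a)⁻¹ * w b) (r b)) = dist a b := by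
      rw [← (w a).dist_eq (r a), ← IsometryEquiv.mul_apply, mul_inv_cancel_left, hwr, hwr]
    rw [e] at h; simpa using h
  exact this.continuous

theorem unique_part (D : Set V)
    (hlf : LocallyFinite fun g : {g : V ≃ᵢ V // g ∈ W ∧ IsAffRefl g} => {x : V | g.1 x = x})
    (hpd : ∀ K : Set V, IsCompact K → {g : V ≃ᵢ V | g ∈ W ∧ ∃ x ∈ K, g x ∈ K}.Finite)
    (hD : ∃ x₀ ∈ (affMirrors W)ᶜ, D = closure (connectedComponentIn (affMirrors W)ᶜ x₀))
    (hdisj : ∀ w ∈ W, ∀ w' ∈ W, w ≠ w' →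
      ∀ x ∈ interior D, ∀ x' ∈ interior D, w x ≠ w' x')
    (g : V → V) (hL : ∀ x₁ x₂ : V, dist (g x₁) (g x₂) ≤ dist x₁ x₂) :
      ∀ w ∈ W, ∀ x ∈ interior D, g x = w x →
        ∀ w' ∈ W, ∀ x' ∈ interior D, g x' = w' x' → w = w' := by
  intro w hw x hx hgx w' hw' x' hx' hgx'
  by_contra hne
  set z := (w⁻¹ * w') x' with hz
  have hvW : w⁻¹ * w' ∈ W := W.mul_mem (W.inv_mem hw) hw'
  have hwz : w z = w' x' := by
    rw [hz, ← IsometryEquiv.mul_apply, mul_inv_cancel_left]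
  have h1 : dist x z ≤ dist x x' := by
    rw [← w.dist_eq x, hwz, ← hgx, ← hgx']; exact hL _ _
  have h2 : ∀ y ∈ D, dist y x' ≤ dist y z := fun y hy => 
    dist_le_orbit W D hlf hpd hD hdisj y x' hy (interior_subset hx') _ hvW
  have hzx : z ≠ x' := fun h => hdisj w hw w' hw' hne x' hx' x' hx' (by rw [← hwz, h])
  -- move `x` slightly toward `z`
  have hc : Filter.Tendsto (fun t : ℝ => x + t • (z - x')) (nhdsWithin 0 (Set.Ioi 0)) (nhds x) := by
    have : Continuous (fun t : ℝ => x + t • (z - x')) := by fun_prop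
    have := this.tendsto 0
    simp only [zero_smul, add_zero] at this
    exact this.mono_left nhdsWithin_le_nhds
  have hev := hc.eventually (isOpen_interior.mem_nhds hx)
  obtain ⟨t, ht, ht0⟩ := (hev.and self_mem_nhdsWithin).exists
  have ht0 : 0 < t := ht0
  have h3 := h2 _ (interior_subset ht)
  rw [dist_eq_norm, dist_eq_norm] at h1 h3
  have h1' := mul_self_le_mul_self (norm_nonneg _) h1
  have h3' := mul_self_le_mul_self (norm_nonneg _) h3
  simp only [← real_inner_self_eq_norm_mul_norm] at h1' h3'
  have e1 : x + t • (z - x') - x' = (x - x') + t • (z-x') := by abel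
  have e2 : x + t • (z - x') - z = (x - z) + t • (z-x') := by abel
  rw [e1, e2, inner_add_add_self, inner_add_add_self (x - z)] at h3'
  simp only [inner_smul_right, real_inner_smul_left] at h3'
  rw [real_inner_comm (x-x') (z-x'), real_inner_comm (x-z) (z-x')] at h3'
  have e3 : ⟪x - x', z - x'⟫ - ⟪x - z, z - x'⟫ = ⟪z - x', z - x'⟫ := by
    rw [← inner_sub_left]; congr 1; abel
  have hp : 0 < ⟪z - x', z - x'⟫ := real_inner_self_pos.2 (sub_ne_zero.2 hzx)
  have := mul_pos ht0 hp
  rw [← e3] at this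
  nlinarith
end Chamber

/-- For a continuous map `g : V → V` there exist `w ∈ W` and `x ∈ D` with `g x = w x`;
if moreover `g` is 1-Lipschitz and the fixed point lies in `D°`, then `w` is the unique
element of `W` such that `w⁻¹ ∘ g` has a fixed point in `D°`. -/
theorem exists_fixed_point_continuous {V : Type*} [NormedAddCommGroup V]
    [InnerProductSpace ℝ V] [FiniteDimensional ℝ V]
    (W : Subgroup (V ≃ᵢ V)) (D : Set V)
    (hWgen : Subgroup.closure {g : V ≃ᵢ V | g ∈ W ∧ IsAffRefl g} = W)
    (hlf : LocallyFinite fun g : {g : V ≃ᵢ V // g ∈ W ∧ IsAffRefl g} => {x : V | g.1 x = x})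
    (hpd : ∀ K : Set V, IsCompact K → {g : V ≃ᵢ V | g ∈ W ∧ ∃ x ∈ K, g x ∈ K}.Finite)
    (hD : ∃ x₀ ∈ (affMirrors W)ᶜ, D = closure (connectedComponentIn (affMirrors W)ᶜ x₀))
    (hDcpt : IsCompact D)
    (hcover : ∀ v : V, ∃ w ∈ W, ∃ x ∈ D, w x = v)
    (hdisj : ∀ w ∈ W, ∀ w' ∈ W, w ≠ w' →
      ∀ x ∈ interior D, ∀ x' ∈ interior D, w x ≠ w' x')
    (g : V → V) (hg : Continuous g) :
    (∃ w ∈ W, ∃ x ∈ D, g x = w x) ∧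
    ((∀ x₁ x₂ : V, dist (g x₁) (g x₂) ≤ dist x₁ x₂) →
      ∀ w ∈ W, ∀ x ∈ interior D, g x = w x →
        ∀ w' ∈ W, ∀ x' ∈ interior D, g x' = w' x' → w = w') := by
  refine ⟨?_, fun hL => unique_part W D hlf hpd hD hdisj g hL⟩
  obtain ⟨r, hr, hrD⟩ := exists_fold W D hlf hpd hD hdisj hcover
  obtain ⟨R, hR⟩ := hDcpt.isBounded.exists_norm_le
  obtain ⟨x, hx⟩ := brouwer_bounded (fun x => r (g x)) (hr.comp hg) R
    (fun x => hR _ (hrD (g x)).1)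
  have hx : r (g x) = x := hx
  obtain ⟨h1, w, hw, h2⟩ := hrD (g x)
  rw [hx] at h1 h2
  exact ⟨w, hw, x, h1, h2.symm⟩
end
end

section
/- For every isometry h of V, the space V is the disjoint union of the sets (h − w)(D°) := {h x − w x : x ∈ D°} over w ∈ W: these sets cover V and are pairwise disjoint for distinct w ∈ W (differences h x − w x are taken in the vector space V). -/
open scoped RealInnerProductSpace

noncomputable section

section TilingHelpers

variable {V : Type*} [NormedAddCommGroup V] [InnerProductSpace ℝ V]

theorem aux_refl_dist (x z u : V) (c : ℝ) (hu : u ≠ 0)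
    (hneg : (⟪x, u⟫ - c) * (⟪z, u⟫ - c) < 0) :
    dist x (z - ((2 * (⟪z, u⟫ - c)) / ⟪u, u⟫) • u) < dist x z := by
  have huu : 0 < ⟪u, u⟫ := real_inner_self_pos.2 hu
  rw [dist_eq_norm, dist_eq_norm]
  apply lt_of_pow_lt_pow_left₀ 2 (norm_nonneg _)
  set k := (2 * (⟪z, u⟫ - c)) / ⟪u, u⟫ with hk
  have e : x - (z - k • u) = (x - z) + k • u := by abel
  rw [e, norm_add_sq_real, inner_smul_right, norm_smul, mul_pow, ← real_inner_self_eq_norm_sq u,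
    inner_sub_left, Real.norm_eq_abs, sq_abs]
  have hk2 : k * ⟪u, u⟫ = 2 * (⟪z, u⟫ - c) := by rw [hk]; field_simp
  have : k ^ 2 * ⟪u, u⟫ = k * (2 * (⟪z, u⟫ - c)) := by rw [← hk2]; ring
  rw [this]
  have : 2 * (k * (⟪x, u⟫ - ⟪z, u⟫)) + k * (2 * (⟪z, u⟫ - c)) = 2 * k * (⟪x, u⟫ - c) := by ring
  have h3 : k * (⟪x, u⟫ - c) < 0 := by
    have : k * (⟪x, u⟫ - c) = 2 * ((⟪x, u⟫ - c) * (⟪z, u⟫ - c)) / ⟪u, u⟫ := by rw [hk]; ring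
    rw [this]
    exact div_neg_of_neg_of_pos (by linarith) huu
  linarith

theorem aux_refl_ne_one {g : V ≃ᵢ V} (hg : IsAffRefl g) : g ≠ 1 := by
  rintro rfl
  obtain ⟨u, c, hu, H⟩ := hg
  have huu : 0 < ⟪u, u⟫ := real_inner_self_pos.2 hu
  have h1 := H (((c + 1) / ⟪u, u⟫) • u)
  have h2 : ⟪((c + 1) / ⟪u, u⟫) • u, u⟫ = c + 1 := by
    rw [real_inner_smul_left]; field_simp
  rw [h2] at h1
  have h3 : ((2 * (c + 1 - c)) / ⟪u, u⟫) • u = 0 := by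
    have h4 : ∀ a b : V, a = a - b → b = 0 := fun a b h => sub_eq_self.1 h.symm
    exact h4 _ _ h1
  rcases smul_eq_zero.1 h3 with h | h
  · have : (2 * (c + 1 - c)) / ⟪u, u⟫ = 2 / ⟪u, u⟫ := by ring
    rw [this] at h
    have : 0 < 2 / ⟪u, u⟫ := by positivity
    linarith
  · exact hu h

theorem aux_mem_mirrors {W : Subgroup (V ≃ᵢ V)} {x : V} :
    x ∈ affMirrors W ↔ ∃ g : V ≃ᵢ V, (g ∈ W ∧ IsAffRefl g) ∧ g x = x := by
  simp [affMirrors]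

/-- Strict Dirichlet property inside the open chamber. -/
theorem aux_dirichlet (W : Subgroup (V ≃ᵢ V)) [FiniteDimensional ℝ V] (x₀ : V) (C : Set V)
    (hC : C = connectedComponentIn (affMirrors W)ᶜ x₀)
    (hpd : ∀ K : Set V, IsCompact K → {g : V ≃ᵢ V | g ∈ W ∧ ∃ x ∈ K, g x ∈ K}.Finite)
    (hdisj : ∀ w ∈ W, ∀ w' ∈ W, w ≠ w' → ∀ x ∈ C, ∀ x' ∈ C, w x ≠ w' x')
    (x y : V) (hx : x ∈ C) (hy : y ∈ C) (g : V ≃ᵢ V) (hg : g ∈ W) (hg1 : g ≠ 1) :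
    dist x y < dist x (g y) := by
  by_contra! hle
  let S : Set (V ≃ᵢ V) := {g | g ∈ W ∧ dist x (g y) ≤ dist x y}
  have hS : S.Finite := by
    refine (hpd (Metric.closedBall x (dist x y)) (isCompact_closedBall _ _)).subset ?_
    rintro k ⟨hk, hk'⟩
    refine ⟨hk, y, ?_, ?_⟩
    · simp [dist_comm]
    · simpa [dist_comm] using hk'
  have key : ∀ k ∈ W, k ≠ 1 → ∃ k' ∈ W, dist x (k' y) < dist x (k y) := by
    intro k hk hk1
    have hky : k y ∉ affMirrors W := by
      rw [aux_mem_mirrors]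
      rintro ⟨r, ⟨hr, hr'⟩, e⟩
      refine hdisj (r * k) (W.mul_mem hr hk) k hk ?_ y hy y hy e
      intro e'
      exact aux_refl_ne_one hr' (by simpa using e')
    have hxm : x ∉ affMirrors W := by
      rw [hC] at hx
      exact connectedComponentIn_subset _ _ hx
    by_cases hseg : segment ℝ x (k y) ⊆ (affMirrors W)ᶜ
    · exfalso
      have h1 : segment ℝ x (k y) ⊆ connectedComponentIn (affMirrors W)ᶜ x :=
        (convex_segment x (k y)).isPreconnected.subset_connectedComponentIn
          (left_mem_segment ℝ _ _) hseg
      have h2 : k y ∈ C := by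
        rw [hC] at hx ⊢
        rw [connectedComponentIn_eq hx]
        exact h1 (right_mem_segment ℝ _ _)
      exact hdisj k hk 1 W.one_mem hk1 y hy (k y) h2 rfl
    · rw [Set.not_subset] at hseg
      obtain ⟨s, hs, hs'⟩ := hseg
      rw [Set.mem_compl_iff, not_not, aux_mem_mirrors] at hs'
      obtain ⟨r, ⟨hr, hr'⟩, e⟩ := hs'
      have hr'' := hr'
      obtain ⟨u, c, hu, H⟩ := hr''
      have huu : 0 < ⟪u, u⟫ := real_inner_self_pos.2 hu
      have hfix : ∀ z, r z = z ↔ ⟪z, u⟫ - c = 0 := by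
        intro z
        rw [H z, sub_eq_self, smul_eq_zero, or_iff_left hu, div_eq_zero_iff,
          or_iff_left huu.ne', mul_eq_zero, or_iff_right two_ne_zero]
      refine ⟨r * k, W.mul_mem hr hk, ?_⟩
      have e2 : (r * k) y = r (k y) := rfl
      rw [e2, H (k y)]
      apply aux_refl_dist _ _ _ _ hu
      have a1 : ⟪x, u⟫ - c ≠ 0 := fun h => hxm (aux_mem_mirrors.2 ⟨r, ⟨hr, hr'⟩, (hfix _).2 h⟩)
      have a2 : ⟪k y, u⟫ - c ≠ 0 := fun h => hky (aux_mem_mirrors.2 ⟨r, ⟨hr, hr'⟩, (hfix _).2 h⟩)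
      have a3 := (hfix s).1 e
      obtain ⟨a, b, ha, hb, hab, rfl⟩ := hs
      rw [inner_add_left, real_inner_smul_left, real_inner_smul_left] at a3
      generalize ⟪x, u⟫ = p at *
      generalize ⟪k y, u⟫ = q at *
      have a4 : a * (p - c) + b * (q - c) = 0 := by linear_combination a3 - c * hab
      by_contra! hge
      have hpos : 0 < (p - c) * (q - c) := lt_of_le_of_ne hge (mul_ne_zero a1 a2).symm
      have a5 : a * (p - c) ^ 2 + b * ((p - c) * (q - c)) = 0 := by
        linear_combination (p - c) * a4
      have hp2 : 0 < (p - c) ^ 2 := by positivity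
      have t1 : 0 ≤ a * (p - c) ^ 2 := by positivity
      have t2 : 0 ≤ b * ((p - c) * (q - c)) := by positivity
      have ha0 : a = 0 := by
        have : a * (p - c) ^ 2 = 0 := by linarith
        exact (mul_eq_zero.1 this).resolve_right hp2.ne'
      have hb0 : b = 0 := by
        have : b * ((p - c) * (q - c)) = 0 := by linarith
        exact (mul_eq_zero.1 this).resolve_right hpos.ne'
      linarith
  have hSne : S.Nonempty := ⟨g, hg, hle⟩
  obtain ⟨m, hm, hmin⟩ := Set.exists_min_image S (fun k => dist x (k y)) hS hSne
  by_cases hm1 : m = 1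
  · subst hm1
    obtain ⟨k', hk', hlt⟩ := key g hg hg1
    have := hmin k' ⟨hk', by linarith⟩
    have e : dist x ((1 : V ≃ᵢ V) y) = dist x y := rfl
    simp only [e] at this
    linarith
  · obtain ⟨k', hk', hlt⟩ := key m hm.1 hm1
    have := hmin k' ⟨hk', hlt.le.trans hm.2⟩
    linarith

/-- Fixed point of the perturbed nonexpansive map. -/
theorem aux_contract [CompleteSpace V] (f : V → V) (hf : LipschitzWith 1 f) (p : V) (t : ℝ)
    (ht : 0 < t) (ht1 : t < 1) : ∃ y, y = (1 - t) • f y + t • p := by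
  have hc : ContractingWith (Real.toNNReal (1 - t)) (fun y => (1 - t) • f y + t • p) := by
    refine ⟨?_, ?_⟩
    · rw [Real.toNNReal_lt_one]; linarith
    · apply LipschitzWith.of_dist_le_mul
      intro a b
      rw [dist_add_right, dist_smul₀, Real.coe_toNNReal _ (by linarith), Real.norm_eq_abs,
        abs_of_pos (by linarith)]
      have := hf.dist_le_mul a b
      simp only [NNReal.coe_one, one_mul] at this
      exact mul_le_mul_of_nonneg_left this (by linarith)
  exact ⟨hc.fixedPoint, hc.fixedPoint_isFixedPt.symm⟩

theorem aux_fix_convex (f : V → V) (hf : LipschitzWith 1 f) : Convex ℝ {x | f x = x} := by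
  intro a ha b hb s t hs ht hst
  simp only [Set.mem_ofPred_eq] at *
  set z := s • a + t • b with hz
  have h1 := hf.dist_le_mul z a
  have h2 := hf.dist_le_mul z b
  rw [ha, dist_eq_norm, dist_eq_norm] at h1
  rw [hb, dist_eq_norm, dist_eq_norm] at h2
  simp only [NNReal.coe_one, one_mul] at h1 h2
  have e1 : z - a = t • (b - a) := by
    have : s = 1 - t := by linarith
    rw [hz, this]; module
  have e2 : z - b = -(s • (b - a)) := by
    have : t = 1 - s := by linarith
    rw [hz, this]; module
  rw [e1, norm_smul, Real.norm_of_nonneg ht] at h1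
  rw [e2, norm_neg, norm_smul, Real.norm_of_nonneg hs] at h2
  have q1 := pow_le_pow_left₀ (norm_nonneg _) h1 2
  have q2 := pow_le_pow_left₀ (norm_nonneg _) h2 2
  set d := f z - z with hd
  have e3 : f z - a = d + t • (b - a) := by rw [← e1, hd]; abel
  have e4 : f z - b = d - s • (b - a) := by
    rw [sub_eq_add_neg d, ← e2, hd]; abel
  rw [e3, norm_add_sq_real, inner_smul_right, norm_smul, Real.norm_of_nonneg ht] at q1
  rw [e4, norm_sub_sq_real, inner_smul_right, norm_smul, Real.norm_of_nonneg hs] at q2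
  have m1 := mul_le_mul_of_nonneg_left q1 hs
  have m2 := mul_le_mul_of_nonneg_left q2 ht
  have : ‖d‖ ^ 2 ≤ 0 := by
    have : (s + t) * ‖d‖ ^ 2 ≤ 0 := by linarith
    rwa [hst, one_mul] at this
  have : ‖d‖ = 0 := by nlinarith [norm_nonneg d]
  exact sub_eq_zero.1 (norm_eq_zero.1 this)

theorem aux_fix_nonempty [FiniteDimensional ℝ V] (f : V → V) (hf : LipschitzWith 1 f)
    (D : Set V) (hD : IsCompact D) (hfD : ∀ y, f y ∈ D) : ∃ x, f x = x := by
  have : ∀ n : ℕ, ∃ y, y = (1 - 1 / ((n : ℝ) + 2)) • f y + (1 / ((n : ℝ) + 2)) • (0 : V) := by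
    intro n
    apply aux_contract f hf
    · positivity
    · rw [div_lt_one (by positivity)]; linarith [(Nat.cast_nonneg n : (0 : ℝ) ≤ n)]
  choose y hy using this
  obtain ⟨a, -, φ, hφ, hlim⟩ := hD.tendsto_subseq (fun n => hfD (y n))
  have ht : Filter.Tendsto (fun n : ℕ => 1 - 1 / ((n : ℝ) + 2)) Filter.atTop (nhds (1 - 0)) := by
    apply Filter.Tendsto.const_sub
    have := (tendsto_one_div_add_atTop_nhds_zero_nat (𝕜 := ℝ)).comp (Filter.tendsto_add_atTop_nat 1)
    refine this.congr fun n => ?_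
    simp only [Function.comp]
    push_cast
    ring
  have h1 : Filter.Tendsto (fun n => y (φ n)) Filter.atTop (nhds ((1 - 0 : ℝ) • a)) := by
    refine ((ht.comp hφ.tendsto_atTop).smul hlim).congr fun n => ?_
    simp only [Function.comp]
    conv_rhs => rw [hy (φ n)]
    simp
  rw [sub_zero, one_smul] at h1
  exact ⟨a, tendsto_nhds_unique ((hf.continuous.tendsto a).comp h1) hlim⟩

/-- Linear-algebra core: the resolvent estimate. -/
theorem aux_linear [FiniteDimensional ℝ V] (A : V →ₗᵢ[ℝ] V) (v : V)
    (t : ℕ → ℝ) (b : ℕ → V) (ht0 : ∀ n, 0 < t n) (ht1 : ∀ n, t n < 1)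
    (htl : Filter.Tendsto t Filter.atTop (nhds 0))
    (hbl : Filter.Tendsto b Filter.atTop (nhds 0))
    (hb : ∀ n, b n = (1 - t n) • A (b n) + t n • v)
    (hpos : ∀ n, 0 ≤ ⟪A (b n), v⟫) : v = 0 := by
  have hort : ∀ k, A k = k → ⟪k, v⟫ = 0 := by
    intro k hk
    have h1 : ∀ n, ⟪k, b n⟫ = ⟪k, v⟫ := by
      intro n
      have e := congrArg (fun z => ⟪k, z⟫) (hb n)
      simp only [inner_add_right, inner_smul_right] at e
      have e2 : ⟪k, A (b n)⟫ = ⟪k, b n⟫ := by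
        conv_lhs => rw [← hk]
        exact A.inner_map_map _ _
      rw [e2] at e
      have : t n * (⟪k, b n⟫ - ⟪k, v⟫) = 0 := by linear_combination e
      have := (mul_eq_zero.1 this).resolve_left (ht0 n).ne'
      linarith
    have h2 : Filter.Tendsto (fun n => ⟪k, b n⟫) Filter.atTop (nhds ⟪k, (0 : V)⟫) :=
      Filter.Tendsto.inner tendsto_const_nhds hbl
    simp only [h1, inner_zero_right] at h2
    exact tendsto_nhds_unique tendsto_const_nhds h2
  have hz : ∃ z, z - A z = v := by
    let R : Submodule ℝ V := LinearMap.range (LinearMap.id - A.toLinearMap)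
    have : v ∈ R := by
      rw [← Submodule.orthogonal_orthogonal R, Submodule.mem_orthogonal]
      intro k hk
      apply hort
      rw [Submodule.mem_orthogonal] at hk
      have h1 := hk (k - A k) ⟨k, by simp⟩
      rw [inner_sub_left, real_inner_self_eq_norm_sq] at h1
      have h2 : ‖A k - k‖ ^ 2 = 0 := by
        rw [norm_sub_sq_real, A.norm_map]; linarith
      exact sub_eq_zero.1 (norm_eq_zero.1 (pow_eq_zero_iff two_ne_zero |>.1 h2))
    obtain ⟨z, hz⟩ := this
    exact ⟨z, by simpa using hz⟩
  obtain ⟨z, hz⟩ := hz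
  have hbound : ∀ n, ‖b n‖ ≤ 2 * t n * ‖z‖ := by
    intro n
    have e : b n - t n • z = (1 - t n) • A (b n - t n • z) - (t n * t n) • A z := by
      conv_lhs => rw [hb n, ← hz]
      rw [map_sub, map_smul]
      module
    have e2 : ‖b n - t n • z‖ ≤ (1 - t n) * ‖b n - t n • z‖ + (t n * t n) * ‖z‖ := by
      conv_lhs => rw [e]
      refine (norm_sub_le _ _).trans ?_
      rw [norm_smul, norm_smul, A.norm_map, A.norm_map,
        Real.norm_of_nonneg (by linarith [ht1 n]),
        Real.norm_of_nonneg (mul_nonneg (ht0 n).le (ht0 n).le)]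
    have e3 : ‖b n - t n • z‖ ≤ t n * ‖z‖ := by
      have : t n * ‖b n - t n • z‖ ≤ t n * (t n * ‖z‖) := by linarith
      exact le_of_mul_le_mul_left this (ht0 n)
    have e4 : ‖b n‖ ≤ ‖b n - t n • z‖ + ‖t n • z‖ := by
      simpa using norm_add_le (b n - t n • z) (t n • z)
    rw [norm_smul, Real.norm_of_nonneg (ht0 n).le] at e4
    linarith
  have hlow : ∀ n, t n * ‖v‖ ^ 2 ≤ 2 * ‖b n‖ ^ 2 := by
    intro n
    have e := congrArg (fun z => ‖z‖ ^ 2) (hb n)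
    rw [norm_add_sq_real, norm_smul, norm_smul, real_inner_smul_left, inner_smul_right,
      A.norm_map, Real.norm_of_nonneg (by linarith [ht1 n] : (0 : ℝ) ≤ 1 - t n),
      Real.norm_of_nonneg (ht0 n).le] at e
    have e2 : t n * ((2 - t n) * ‖b n‖ ^ 2) =
        t n * (2 * (1 - t n) * ⟪A (b n), v⟫ + t n * ‖v‖ ^ 2) := by
      linear_combination e
    have e3 := mul_left_cancel₀ (ht0 n).ne' e2
    have e4 : 0 ≤ 2 * (1 - t n) * ⟪A (b n), v⟫ :=
      mul_nonneg (by linarith [ht1 n]) (hpos n)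
    have e5 : 0 ≤ t n * ‖b n‖ ^ 2 := mul_nonneg (ht0 n).le (by positivity)
    linarith
  have hfin : ∀ n, ‖v‖ ^ 2 ≤ 8 * ‖z‖ ^ 2 * t n := by
    intro n
    have e1 := hlow n
    have e2 := pow_le_pow_left₀ (norm_nonneg _) (hbound n) 2
    have : t n * ‖v‖ ^ 2 ≤ t n * (8 * ‖z‖ ^ 2 * t n) := by nlinarith
    exact le_of_mul_le_mul_left this (ht0 n)
  have h0 : ‖v‖ ^ 2 ≤ 8 * ‖z‖ ^ 2 * 0 :=
    ge_of_tendsto' (htl.const_mul _) hfin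
  have : ‖v‖ = 0 := by nlinarith [norm_nonneg v]
  exact norm_eq_zero.1 this

theorem aux_halpern [FiniteDimensional ℝ V] (f : V → V) (hf : LipschitzWith 1 f)
    (x v : V) (hx : f x = x) (hv : ∀ c, f c = c → ⟪v, c - x⟫ ≤ 0) :
    ∃ (t : ℕ → ℝ) (y : ℕ → V), (∀ n, 0 < t n) ∧ (∀ n, t n < 1) ∧
      Filter.Tendsto t Filter.atTop (nhds 0) ∧ Filter.Tendsto y Filter.atTop (nhds x) ∧
      ∀ n, y n - x = (1 - t n) • (f (y n) - x) + t n • v := by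
  let t : ℕ → ℝ := fun n => 1 / ((n : ℝ) + 2)
  have ht0 : ∀ n, 0 < t n := fun n => by simp only [t]; positivity
  have ht1 : ∀ n, t n < 1 := fun n => by
    simp only [t]
    rw [div_lt_one (by positivity)]; linarith [(Nat.cast_nonneg n : (0 : ℝ) ≤ n)]
  have htl : Filter.Tendsto t Filter.atTop (nhds 0) := by
    have := (tendsto_one_div_add_atTop_nhds_zero_nat (𝕜 := ℝ)).comp (Filter.tendsto_add_atTop_nat 1)
    refine this.congr fun n => ?_
    simp only [Function.comp, t]
    push_cast
    ring
  choose y hy using fun n => aux_contract f hf (x + v) (t n) (ht0 n) (ht1 n)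
  have hy' : ∀ n, y n - x = (1 - t n) • (f (y n) - x) + t n • v := by
    intro n
    conv_lhs => rw [hy n]
    module
  have hne : ∀ n, ‖f (y n) - x‖ ≤ ‖y n - x‖ := by
    intro n
    have := hf.dist_le_mul (y n) x
    rw [hx, dist_eq_norm, dist_eq_norm] at this
    simpa using this
  have hin : ∀ n, ‖y n - x‖ ^ 2 ≤ ⟪v, y n - x⟫ := by
    intro n
    have e := congrArg (fun z => ⟪z, y n - x⟫) (hy' n)
    simp only [inner_add_left, real_inner_smul_left] at e
    rw [real_inner_self_eq_norm_sq] at e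
    have e1 : ⟪f (y n) - x, y n - x⟫ ≤ ‖y n - x‖ ^ 2 := by
      refine (real_inner_le_norm _ _).trans ?_
      rw [sq]
      exact mul_le_mul_of_nonneg_right (hne n) (norm_nonneg _)
    have e2 := mul_le_mul_of_nonneg_left e1 (by linarith [ht1 n] : (0 : ℝ) ≤ 1 - t n)
    have : t n * ‖y n - x‖ ^ 2 ≤ t n * ⟪v, y n - x⟫ := by linarith
    exact le_of_mul_le_mul_left this (ht0 n)
  have hbd : ∀ n, y n ∈ Metric.closedBall x ‖v‖ := by
    intro n
    rw [Metric.mem_closedBall, dist_eq_norm]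
    have e := (hin n).trans (real_inner_le_norm _ _)
    by_contra! hlt
    have : 0 < ‖y n - x‖ := lt_of_le_of_lt (norm_nonneg _) hlt
    nlinarith
  obtain ⟨c, -, φ, hφ, hlim⟩ := (isCompact_closedBall x ‖v‖).tendsto_subseq hbd
  have htφ : Filter.Tendsto (fun n => t (φ n)) Filter.atTop (nhds 0) := htl.comp hφ.tendsto_atTop
  have hfc : f c = c := by
    have h1 : Filter.Tendsto (fun n => f (y (φ n))) Filter.atTop (nhds (f c)) :=
      (hf.continuous.tendsto c).comp hlim
    have h2 : Filter.Tendsto (fun n => (1 - t (φ n)) • f (y (φ n)) + t (φ n) • (x + v))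
        Filter.atTop (nhds ((1 - 0 : ℝ) • f c + (0 : ℝ) • (x + v))) :=
      ((htφ.const_sub 1).smul h1).add (htφ.smul_const _)
    have h3 : Filter.Tendsto (fun n => y (φ n)) Filter.atTop
        (nhds ((1 - 0 : ℝ) • f c + (0 : ℝ) • (x + v))) :=
      h2.congr fun n => (hy (φ n)).symm
    have := tendsto_nhds_unique h3 hlim
    simpa using this
  have hcx : c = x := by
    have h1 : Filter.Tendsto (fun n => y (φ n) - x) Filter.atTop (nhds (c - x)) :=
      hlim.sub_const x
    have h2 : ‖c - x‖ ^ 2 ≤ ⟪v, c - x⟫ :=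
      le_of_tendsto_of_tendsto' (h1.norm.pow 2) (Filter.Tendsto.inner tendsto_const_nhds h1)
        (fun n => hin (φ n))
    have h3 := hv c hfc
    have : ‖c - x‖ = 0 := by nlinarith [norm_nonneg (c - x)]
    exact sub_eq_zero.1 (norm_eq_zero.1 this)
  subst hcx
  exact ⟨t ∘ φ, y ∘ φ, fun n => ht0 _, fun n => ht1 _, htφ, hlim, fun n => hy' _⟩

theorem aux_relint [FiniteDimensional ℝ V] (F : Set V) (hF : Convex ℝ F) (hne : F.Nonempty) :
    ∃ x ∈ F, ∀ c ∈ F, ∃ ε : ℝ, 0 < ε ∧ x - ε • (c - x) ∈ F := by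
  obtain ⟨x, hx⟩ := hne.intrinsicInterior hF
  have hxF := intrinsicInterior_subset hx
  refine ⟨x, hxF, fun c hc => ?_⟩
  rw [mem_intrinsicInterior] at hx
  obtain ⟨x', hx', rfl⟩ := hx
  have hmem : ∀ ε : ℝ, (x' : V) - ε • (c - x') ∈ affineSpan ℝ F := by
    intro ε
    have := AffineMap.lineMap_mem (-ε) x'.2 (subset_affineSpan ℝ F hc)
    rw [AffineMap.lineMap_apply] at this
    simp only [vsub_eq_sub, vadd_eq_add] at this
    convert this using 1
    module
  let γ : ℝ → affineSpan ℝ F := fun ε => ⟨(x' : V) - ε • (c - x'), hmem ε⟩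
  have hγ : Continuous γ := by
    apply Continuous.subtype_mk
    fun_prop
  have h0 : γ 0 = x' := by
    apply Subtype.ext
    simp [γ]
  have hev : ∀ᶠ ε in nhds (0 : ℝ), γ ε ∈ ((↑) ⁻¹' F : Set (affineSpan ℝ F)) := by
    apply hγ.continuousAt
    rw [h0]
    exact mem_interior_iff_mem_nhds.1 hx'
  obtain ⟨δ, hδ, H⟩ := Metric.eventually_nhds_iff.1 hev
  refine ⟨δ / 2, by positivity, H ?_⟩
  rw [Real.dist_eq, sub_zero, abs_of_pos (by positivity)]
  linarith

theorem aux_cover [FiniteDimensional ℝ V]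
    (W : Subgroup (V ≃ᵢ V)) (D : Set V) (p0 : V)
    (hpd : ∀ K : Set V, IsCompact K → {g : V ≃ᵢ V | g ∈ W ∧ ∃ x ∈ K, g x ∈ K}.Finite)
    (hDcpt : IsCompact D)
    (hcover : ∀ v : V, ∃ w ∈ W, ∃ x ∈ D, w x = v)
    (hp0 : p0 ∈ D)
    (hp1 : ∀ w ∈ W, w ≠ 1 → w p0 ≠ p0)
    (hdir : ∀ w ∈ W, ∀ x ∈ D, ∀ y ∈ D, dist x y ≤ dist x (w y))
    (h : V ≃ᵢ V) :
    ∃ w ∈ W, ∃ x ∈ D, h x = w x ∧ ∀ g ∈ W, g x = x → g = 1 := by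
  choose w hw φ hφ hwφ using hcover
  let f : V → V := fun y => φ (h y)
  have hf : LipschitzWith 1 f := by
    apply LipschitzWith.of_dist_le_mul
    intro a b
    simp only [NNReal.coe_one, one_mul, f]
    have h1 := hdir ((w (h a))⁻¹ * w (h b)) (W.mul_mem (W.inv_mem (hw _)) (hw _))
      (φ (h a)) (hφ _) (φ (h b)) (hφ _)
    refine h1.trans_eq ?_
    rw [← (w (h a)).dist_eq, ← h.dist_eq a b]
    have e : (w (h a)) (((w (h a))⁻¹ * w (h b)) (φ (h b))) = w (h b) (φ (h b)) := by
      rw [← IsometryEquiv.mul_apply]; simp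
    rw [e, hwφ, hwφ]
  obtain ⟨x, hxF, hrel⟩ := aux_relint {x | f x = x} (aux_fix_convex f hf)
    (aux_fix_nonempty f hf D hDcpt (fun y => hφ _))
  have hfx : f x = x := hxF
  have hxD : x ∈ D := hfx ▸ hφ _
  refine ⟨w (h x), hw _, x, hxD, ?_, ?_⟩
  · conv_lhs => rw [← hwφ (h x)]
    exact congrArg _ hfx
  intro g hg hgx
  by_contra hg1
  set v := p0 - g p0 with hv
  have hv0 : v ≠ 0 := fun e => hp1 g hg hg1 (sub_eq_zero.1 e).symm
  have hvD : ∀ c ∈ D, 0 ≤ ⟪c - x, v⟫ := by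
    intro c hc
    have h1 := hdir g hg c hc p0 hp0
    have h2 : dist (g p0) x = dist p0 x := by
      conv_lhs => rw [← hgx]
      exact g.dist_eq _ _
    rw [dist_eq_norm, dist_eq_norm] at h1 h2
    have q1 := pow_le_pow_left₀ (norm_nonneg _) h1 2
    have e1 : c - p0 = (c - x) - (p0 - x) := by abel
    have e2 : c - g p0 = (c - x) - (g p0 - x) := by abel
    have e3 : v = (p0 - x) - (g p0 - x) := by rw [hv]; abel
    rw [e1, e2, norm_sub_sq_real (c - x) (p0 - x), norm_sub_sq_real (c - x) (g p0 - x), h2] at q1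
    rw [e3, inner_sub_right]
    linarith
  have hvF : ∀ c, f c = c → ⟪v, c - x⟫ ≤ 0 := by
    intro c hc
    obtain ⟨ε, hε, hm⟩ := hrel c hc
    have hm' : f (x - ε • (c - x)) = x - ε • (c - x) := hm
    have h1 := hvD _ (hm' ▸ hφ _ : x - ε • (c - x) ∈ D)
    have e : x - ε • (c - x) - x = -(ε • (c - x)) := by abel
    rw [e, inner_neg_left, real_inner_smul_left, real_inner_comm] at h1
    by_contra! hlt
    nlinarith [mul_pos hε hlt]
  obtain ⟨t, y, ht0, ht1, htl, hyl, hy⟩ := aux_halpern f hf x v hfx hvF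
  obtain ⟨K, hK, hDK, hyK⟩ : ∃ K : Set V, IsCompact K ∧ D ⊆ K ∧ ∀ n, h (y n) ∈ K := by
    have h1 : Filter.Tendsto (fun n => h (y n)) Filter.atTop (nhds (h x)) :=
      (h.continuous.tendsto x).comp hyl
    exact ⟨D ∪ insert (h x) (Set.range fun n => h (y n)), hDcpt.union h1.isCompact_insert_range,
      Set.subset_union_left, fun n => Or.inr (Or.inr ⟨n, rfl⟩)⟩
  have hfin : (Set.range fun n => w (h (y n))).Finite := by
    refine (hpd K hK).subset ?_
    rintro _ ⟨n, rfl⟩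
    exact ⟨hw _, φ (h (y n)), hDK (hφ _), by rw [hwφ]; exact hyK n⟩
  obtain ⟨k, hk⟩ : ∃ k : V ≃ᵢ V, ∃ᶠ n in Filter.atTop, w (h (y n)) = k := by
    by_contra! hcon
    have h1 : ∀ᶠ n in Filter.atTop, ∀ k ∈ Set.range (fun n => w (h (y n))), w (h (y n)) ≠ k :=
      (Filter.eventually_all_finite hfin).2 fun k _ => hcon k
    obtain ⟨n, hn⟩ := h1.exists
    exact hn _ ⟨n, rfl⟩ rfl
  obtain ⟨ψ, hψ, hψk⟩ := Filter.extraction_of_frequently_atTop hk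
  let q : V ≃ᵢ V := h.trans k.symm
  have hq : ∀ n, f (y (ψ n)) = q (y (ψ n)) := by
    intro n
    have e := hwφ (h (y (ψ n)))
    rw [hψk n] at e
    simp only [q, IsometryEquiv.trans_apply, f]
    rw [← e, IsometryEquiv.symm_apply_apply, e]
  have hylψ : Filter.Tendsto (fun n => y (ψ n)) Filter.atTop (nhds x) :=
    hyl.comp hψ.tendsto_atTop
  have hqx : q x = x := by
    have h1 := (q.continuous.tendsto x).comp hylψ
    have h2 := (hf.continuous.tendsto x).comp hylψ
    rw [hfx] at h2
    exact tendsto_nhds_unique h1 (h2.congr fun n => hq n)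
  let Q := q.toRealAffineIsometryEquiv
  have hQ : ∀ z, q z - x = Q.linearIsometryEquiv (z - x) := by
    intro z
    have := Q.map_vsub z x
    simp only [vsub_eq_sub] at this
    rw [this]
    simp [Q, hqx]
  refine hv0 (aux_linear Q.linearIsometryEquiv.toLinearIsometry v (fun n => t (ψ n))
    (fun n => y (ψ n) - x) (fun n => ht0 _) (fun n => ht1 _) (htl.comp hψ.tendsto_atTop)
    ?_ ?_ ?_)
  · simpa using hylψ.sub_const x
  · intro n
    have := hy (ψ n)
    rw [hq, hQ] at this
    exact this
  · intro n
    have : Q.linearIsometryEquiv.toLinearIsometry (y (ψ n) - x) = f (y (ψ n)) - x := by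
      rw [hq, hQ]; rfl
    rw [this]
    exact hvD _ (hφ _)

end TilingHelpers

/-- For every isometry `h` of `V`, the space `V` is the disjoint union over `w ∈ W` of
the sets `(h - w)(D°) = {h x - w x : x ∈ D°}`. -/
theorem tiling_sub_isometry {V : Type*} [NormedAddCommGroup V] [InnerProductSpace ℝ V]
    [FiniteDimensional ℝ V]
    (W : Subgroup (V ≃ᵢ V)) (D : Set V)
    (hWgen : Subgroup.closure {g : V ≃ᵢ V | g ∈ W ∧ IsAffRefl g} = W)
    (hlf : LocallyFinite fun g : {g : V ≃ᵢ V // g ∈ W ∧ IsAffRefl g} => {x : V | g.1 x = x})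
    (hpd : ∀ K : Set V, IsCompact K → {g : V ≃ᵢ V | g ∈ W ∧ ∃ x ∈ K, g x ∈ K}.Finite)
    (hD : ∃ x₀ ∈ (affMirrors W)ᶜ, D = closure (connectedComponentIn (affMirrors W)ᶜ x₀))
    (hDcpt : IsCompact D)
    (hcover : ∀ v : V, ∃ w ∈ W, ∃ x ∈ D, w x = v)
    (hdisj : ∀ w ∈ W, ∀ w' ∈ W, w ≠ w' →
      ∀ x ∈ interior D, ∀ x' ∈ interior D, w x ≠ w' x')
    (h : V ≃ᵢ V) :
    (∀ u : V, ∃ w ∈ W, ∃ x ∈ interior D, u = h x - w x) ∧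
    (∀ w ∈ W, ∀ w' ∈ W, w ≠ w' →
      Disjoint {u : V | ∃ x ∈ interior D, u = h x - w x}
        {u : V | ∃ x ∈ interior D, u = h x - w' x}) := by
  obtain ⟨x₀, hx₀, hDC⟩ := hD
  set C := connectedComponentIn (affMirrors W)ᶜ x₀ with hC
  have hclosed : IsClosed (affMirrors W) := by
    have h1 := hlf.isClosed_iUnion (fun g =>
      isClosed_eq g.1.continuous continuous_id)
    convert h1 using 1
    ext x
    simp [aux_mem_mirrors]
  have hCo : IsOpen C := hclosed.isOpen_compl.connectedComponentIn
  have hCD : C ⊆ interior D := interior_maximal (hDC ▸ subset_closure) hCo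
  have hx₀C : x₀ ∈ C := mem_connectedComponentIn hx₀
  have hoff : ∀ x ∈ D, x ∉ affMirrors W → x ∈ C := by
    intro x hx hxm
    obtain ⟨ε, hε, hball⟩ := Metric.isOpen_iff.1 hclosed.isOpen_compl x hxm
    rw [hDC] at hx
    obtain ⟨y, hyC, hyd⟩ := Metric.mem_closure_iff.1 hx ε hε
    have hyb : y ∈ Metric.ball x ε := by rwa [Metric.mem_ball, dist_comm]
    have h1 : Metric.ball x ε ⊆ connectedComponentIn (affMirrors W)ᶜ y :=
      (convex_ball x ε).isPreconnected.subset_connectedComponentIn hyb hball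
    rw [hC, connectedComponentIn_eq hyC]
    exact h1 (Metric.mem_ball_self hε)
  have hint : ∀ x ∈ interior D, x ∈ C := by
    intro x hx
    apply hoff x (interior_subset hx)
    rw [aux_mem_mirrors]
    rintro ⟨r, ⟨hr, hr'⟩, e⟩
    exact hdisj r hr 1 W.one_mem (aux_refl_ne_one hr') x hx x hx e
  have hdir := aux_dirichlet W x₀ C hC hpd
    (fun w hw w' hw' hne x hx x' hx' => hdisj w hw w' hw' hne x (hCD hx) x' (hCD hx'))
  have hdirC : ∀ w ∈ W, ∀ x ∈ C, ∀ y ∈ C, dist x y ≤ dist x (w y) := by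
    intro w hw x hx y hy
    by_cases hw1 : w = 1
    · subst hw1; exact le_rfl
    · exact (hdir x y hx hy w hw hw1).le
  have hdirD : ∀ w ∈ W, ∀ x ∈ D, ∀ y ∈ D, dist x y ≤ dist x (w y) := by
    intro w hw x hx y hy
    have hcl : IsClosed {p : V × V | dist p.1 p.2 ≤ dist p.1 (w p.2)} := by
      apply isClosed_le
      · fun_prop
      · exact continuous_fst.dist (w.continuous.comp continuous_snd)
    have hsub : C ×ˢ C ⊆ {p : V × V | dist p.1 p.2 ≤ dist p.1 (w p.2)} :=
      fun p hp => hdirC w hw p.1 hp.1 p.2 hp.2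
    have h1 := closure_minimal hsub hcl
    rw [closure_prod_eq, ← hDC] at h1
    exact h1 (Set.mk_mem_prod hx hy)
  refine ⟨?_, ?_⟩
  · intro u
    obtain ⟨w, hw, x, hx, e, hst⟩ := aux_cover W D x₀ hpd hDcpt hcover
      (interior_subset (hCD hx₀C))
      (fun w hw hw1 e => hdisj w hw 1 W.one_mem hw1 x₀ (hCD hx₀C) x₀ (hCD hx₀C) e)
      hdirD (h.trans (IsometryEquiv.subRight u))
    refine ⟨w, hw, x, hCD (hoff x hx ?_), ?_⟩
    · rw [aux_mem_mirrors]
      rintro ⟨r, ⟨hr, hr'⟩, e'⟩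
      exact aux_refl_ne_one hr' (hst r hr e')
    · have e2 : h x - u = w x := e
      rw [← e2]; abel
  · intro w hw w' hw' hne
    rw [Set.disjoint_left]
    rintro u ⟨x, hx, e1⟩ ⟨y, hy, e2⟩
    have h1 := hdir x y (hint x hx) (hint y hy) (w⁻¹ * w') (W.mul_mem (W.inv_mem hw) hw')
      (fun e => hne (inv_mul_eq_one.1 e))
    rw [← w.dist_eq x ((w⁻¹ * w') y), ← IsometryEquiv.mul_apply, mul_inv_cancel_left,
      ← h.dist_eq, dist_eq_norm, dist_eq_norm] at h1
    have : h x - h y = w x - w' y := by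
      have e3 := e1.symm.trans e2
      rw [sub_eq_sub_iff_add_eq_add] at e3 ⊢
      rw [e3]; abel
    rw [this] at h1
    exact lt_irrefl _ h1
end
end
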